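/- Assume the standing hypotheses on μ, and fix 0 < θ < α/2. Then there is a constant C (depending on C₀, α, θ) such that for all 0 < r ≤ 1/2, all 0 < s ≤ r/4, and all z ∈ Σ_s ∩ B(0,2) (where Σ_s = (1/s)Σ), one has | Q_{0,r}(z) − |z|² | ≤ C·(s/r) + C·r^{2+α}/s² + C·r^{1+θ}/s. -/

import Mathlib

open Metric Set MeasureTheory Filter Module
open scoped RealInnerProductSpace Topology Pointwise ENNReal

noncomputable section

/-- `ℝⁿ` as a Euclidean space. -/
abbrev E (n : ℕ) : Type := EuclideanSpace ℝ (Fin n)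

/-- `d(A,B) = sup_{a ∈ A} inf_{b ∈ B} |a - b|`. -/
def setD {n : ℕ} (A B : Set (E n)) : ℝ := ⨆ a ∈ A, Metric.infDist a B

/-- `d^{x,r}(A,B) = (1/r) d(A ∩ B(x,r), B ∩ B(x,r))`. -/
def dxr {n : ℕ} (x : E n) (r : ℝ) (A B : Set (E n)) : ℝ :=
  (1 / r) * setD (A ∩ closedBall x r) (B ∩ closedBall x r)

/-- `D^{x,r}(A,B) = max(d^{x,r}(A,B), d^{x,r}(B,A))`. -/
def Dxr {n : ℕ} (x : E n) (r : ℝ) (A B : Set (E n)) : ℝ :=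
  max (dxr x r A B) (dxr x r B A)

/-- `d̃^{x,r}(A,B) = (1/r) d(A ∩ B(x,r), B)`. -/
def dtxr {n : ℕ} (x : E n) (r : ℝ) (A B : Set (E n)) : ℝ :=
  (1 / r) * setD (A ∩ closedBall x r) B

/-- `D̃^{x,r}(A,B) = max(d̃^{x,r}(A,B), d̃^{x,r}(B,A))`. -/
def Dtxr {n : ℕ} (x : E n) (r : ℝ) (A B : Set (E n)) : ℝ :=
  max (dtxr x r A B) (dtxr x r B A)

/-- `C` is a cone based at `y`: `y ∈ C` and `s • (C − y) = C − y` for all `s > 0`. -/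
def IsConeAt {n : ℕ} (y : E n) (C : Set (E n)) : Prop :=
  y ∈ C ∧ ∀ s : ℝ, 0 < s → s • {z : E n | y + z ∈ C} = {z : E n | y + z ∈ C}

/-- The standard KP cone `{x₄² = x₁² + x₂² + x₃²}` in `ℝⁿ`, `n ≥ 4`. -/
def stdKP (n : ℕ) (hn : 4 ≤ n) : Set (E n) :=
  {x : E n | (x ⟨3, by omega⟩) ^ 2 =
    (x ⟨0, by omega⟩) ^ 2 + (x ⟨1, by omega⟩) ^ 2 + (x ⟨2, by omega⟩) ^ 2}

/-- `C` is a KP cone based at `y`: in some orthonormal coordinates centered at the origin,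
`C − y` is the standard KP cone. -/
def IsKPCone {n : ℕ} (hn : 4 ≤ n) (y : E n) (C : Set (E n)) : Prop :=
  ∃ f : E n ≃ₗᵢ[ℝ] E n, {z : E n | y + z ∈ C} = f ⁻¹' stdKP n hn

/-- `θ^P_Σ(x,r)` : best approximation of `S` in `B(x,r)` by affine `m`-planes through `x`. -/
def thetaP {n : ℕ} (m : ℕ) (S : Set (E n)) (x : E n) (r : ℝ) : ℝ :=
  ⨅ L : {L : AffineSubspace ℝ (E n) // x ∈ L ∧ Module.finrank ℝ L.direction = m},
    Dxr x r S (L.1 : Set (E n))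

/-- `θ^C_Σ(x,r)` : best approximation of `S` in `B(x,r)` by KP cones based at `x`. -/
def thetaC {n : ℕ} (hn : 4 ≤ n) (S : Set (E n)) (x : E n) (r : ℝ) : ℝ :=
  ⨅ C : {C : Set (E n) // IsKPCone hn x C}, Dxr x r S C.1

/-- `ϑ^C_Σ(x,r)` : best approximation of `S` in `B(x,r)` by KP cones containing `x`. -/
def varthetaC {n : ℕ} (hn : 4 ≤ n) (S : Set (E n)) (x : E n) (r : ℝ) : ℝ :=
  ⨅ C : {C : Set (E n) // (∃ y, IsKPCone hn y C) ∧ x ∈ C}, Dxr x r S C.1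

/-- The angle `∠(P₁,P₂) = arcsin Γ(P₁,P₂)` between two affine planes. -/
def planeAngle {n : ℕ} (P₁ P₂ : AffineSubspace ℝ (E n)) : ℝ :=
  Real.arcsin (dxr (0 : E n) 1 (P₁.direction : Set (E n)) (P₂.direction : Set (E n)))

/-- The support of a measure. -/
def msupp {n : ℕ} (μ : Measure (E n)) : Set (E n) :=
  {x : E n | ∀ r : ℝ, 0 < r → 0 < μ (closedBall x r)}

/-- Weak convergence of a sequence of measures in the sense of Radon measures. -/
def VagueTendsto {n : ℕ} (μs : ℕ → Measure (E n)) (ν : Measure (E n)) : Prop :=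
  ∀ f : E n → ℝ, Continuous f → HasCompactSupport f →
    Tendsto (fun i => ∫ y, f y ∂(μs i)) atTop (nhds (∫ y, f y ∂ν))

/-- `ν` is a tangent measure of `μ` at `x`: `ν ≠ 0` and for some `rᵢ ↓ 0`, `cᵢ > 0`,
`cᵢ (T_{x,rᵢ})₊μ → ν` weakly. -/
def IsTangentMeasure {n : ℕ} (μ ν : Measure (E n)) (x : E n) : Prop :=
  ν ≠ 0 ∧ ∃ r c : ℕ → ℝ, (∀ i, 0 < r i) ∧ Tendsto r atTop (nhds 0) ∧ (∀ i, 0 < c i) ∧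
    VagueTendsto (fun i => ENNReal.ofReal (c i) • Measure.map (fun y => (r i)⁻¹ • (y - x)) μ) ν

/-- `μ` is `m`-asymptotically optimally doubling. -/
def AOD {n : ℕ} (m : ℕ) (μ : Measure (E n)) : Prop :=
  ∀ K : Set (E n), K ⊆ msupp μ → IsCompact K → ∀ δ : ℝ, 0 < δ →
    ∃ r₀ : ℝ, 0 < r₀ ∧ ∀ x ∈ K, ∀ r : ℝ, 0 < r → r ≤ r₀ →
      ∀ τ : ℝ, τ ∈ Set.Icc (1/2 : ℝ) 1 →
        |(μ (closedBall x (τ * r))).toReal / (μ (closedBall x r)).toReal - τ ^ m| < δ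

/-- `ν` is `m`-flat: `m`-dimensional Hausdorff measure restricted to an affine `m`-plane. -/
def IsFlatMeasure {n : ℕ} (m : ℕ) (ν : Measure (E n)) : Prop :=
  ∃ L : AffineSubspace ℝ (E n), (L : Set (E n)).Nonempty ∧
    Module.finrank ℝ L.direction = m ∧
    ν = (Measure.hausdorffMeasure (m : ℝ)).restrict (L : Set (E n))

/-- Volume of the unit ball in `ℝᵐ`. -/
def unitBallVol (m : ℕ) : ℝ := (volume (Metric.ball (0 : EuclideanSpace ℝ (Fin m)) 1)).toReal

/-- `ω₃`, the volume of the unit `3`-ball. -/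
def omega3 : ℝ := unitBallVol 3

/-- The second moment `Q_{0,r}` of a measure on `ℝ⁴`. -/
def Qmom (μ : Measure (E 4)) (r : ℝ) (z : E 4) : ℝ :=
  (5 / (omega3 * r ^ 5)) * ∫ w in closedBall (0 : E 4) r, ⟪z, w⟫ ^ 2 ∂μ

/-- Entries `q_{ij}` of the second moment matrix in given directions. -/
def qmom (μ : Measure (E 4)) (r : ℝ) (u v : E 4) : ℝ :=
  (5 / (omega3 * r ^ 5)) * ∫ w in closedBall (0 : E 4) r, ⟪u, w⟫ * ⟪v, w⟫ ∂μ

/-- `μ` is `(α,m)`-Hölder asymptotically uniform. -/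
def HolderAsympUniform {n : ℕ} (α : ℝ) (m : ℕ) (μ : Measure (E n)) : Prop :=
  ∀ K : Set (E n), K ⊆ msupp μ → IsCompact K →
    ∃ C r₀ : ℝ, 0 < r₀ ∧ ∀ x ∈ K, ∀ r : ℝ, 0 < r → r ≤ r₀ →
      |(μ (closedBall x r)).toReal / (unitBallVol m * r ^ m) - 1| ≤ C * r ^ α

/-- `φ` is a `C^{1,β}` diffeomorphism from `U` onto `U'`: a continuously differentiable bijection
with `β`-Hölder derivative whose inverse is also `C^{1,β}`. -/
def IsC1HolderDiffeoOn (β : ℝ) (U U' : Set (E 4)) (φ : E 4 → E 4) : Prop :=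
  Set.BijOn φ U U' ∧
  (∀ x ∈ U, HasFDerivAt φ (fderiv ℝ φ x) x) ∧
  (∃ M : ℝ, ∀ x ∈ U, ∀ y ∈ U, ‖fderiv ℝ φ x - fderiv ℝ φ y‖ ≤ M * ‖x - y‖ ^ β) ∧
  ∃ ψ : E 4 → E 4, Set.BijOn ψ U' U ∧
    (∀ x ∈ U, ψ (φ x) = x) ∧ (∀ y ∈ U', φ (ψ y) = y) ∧
    (∀ y ∈ U', HasFDerivAt ψ (fderiv ℝ ψ y) y) ∧
    (∃ M : ℝ, ∀ x ∈ U', ∀ y ∈ U', ‖fderiv ℝ ψ x - fderiv ℝ ψ y‖ ≤ M * ‖x - y‖ ^ β)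


theorem msupp_eq {n : ℕ} (μ : Measure (E n)) : msupp μ = μ.support := by
  ext x
  rw [Measure.mem_support_iff_forall]
  constructor
  · intro h U hU
    obtain ⟨r, hr, hrU⟩ := Metric.nhds_basis_closedBall.mem_iff.1 hU
    exact lt_of_lt_of_le (h r hr) (measure_mono hrU)
  · intro h r hr
    exact h _ (closedBall_mem_nhds x hr)

theorem msupp_closed {n : ℕ} (μ : Measure (E n)) : IsClosed (msupp μ) := by
  rw [msupp_eq]; exact Measure.isClosed_support

theorem msupp_ae {n : ℕ} (μ : Measure (E n)) : ∀ᵐ x ∂μ, x ∈ msupp μ := by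
  rw [msupp_eq]; exact Measure.support_mem_ae

/-- normalized density hypothesis -/
structure Good (ν : Measure (E 4)) (η R : ℝ) : Prop where
  lf : IsLocallyFiniteMeasure ν
  zero : (0 : E 4) ∈ msupp ν
  Rpos : 0 < R
  eta : η ≤ 1 / 10
  dens : ∀ x ∈ msupp ν, ‖x‖ ≤ R → ∀ t : ℝ, 0 < t → t ≤ R →
    |ν.real (closedBall x t) - t ^ 3| ≤ η * t ^ 3

theorem Good.eta0 {ν : Measure (E 4)} {η R : ℝ} (h : Good ν η R) : 0 ≤ η := by
  have h1 := h.dens 0 h.zero (by simpa using h.Rpos.le) R h.Rpos le_rfl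
  have h2 := (abs_nonneg _).trans h1
  have : 0 < R ^ 3 := by have := h.Rpos; positivity
  by_contra hc
  nlinarith [mul_pos_of_neg_of_neg (not_le.1 hc) (neg_neg_of_pos this)]

theorem Good.mono {ν : Measure (E 4)} {η R R' : ℝ} (h : Good ν η R) (h0 : 0 < R') (hR : R' ≤ R) :
    Good ν η R' :=
  ⟨h.lf, h.zero, h0, h.eta, fun x hx hxR t ht htR => h.dens x hx (hxR.trans hR) t ht (htR.trans hR)⟩

theorem Good.mono_eta {ν : Measure (E 4)} {η η' R : ℝ} (h : Good ν η R) (h0 : η ≤ η')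
    (h1 : η' ≤ 1 / 10) : Good ν η' R :=
  ⟨h.lf, h.zero, h.Rpos, h1, fun x hx hxR t ht htR => (h.dens x hx hxR t ht htR).trans
    (by have : 0 < t ^ 3 := by positivity
        nlinarith)⟩

/-- translated measure -/
def tr (ν : Measure (E 4)) (y : E 4) : Measure (E 4) := ν.map (fun w => w - y)

theorem tr_ball (ν : Measure (E 4)) (y x : E 4) (t : ℝ) :
    tr ν y (closedBall x t) = ν (closedBall (y + x) t) := by
  rw [tr, Measure.map_apply (by fun_prop) measurableSet_closedBall]
  congr 1
  ext w
  simp only [mem_preimage, mem_closedBall, dist_eq_norm]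
  rw [show w - y - x = w - (y + x) by abel]

theorem mem_msupp_tr (ν : Measure (E 4)) (y x : E 4) : x ∈ msupp (tr ν y) ↔ y + x ∈ msupp ν := by
  simp only [msupp, mem_ofPred_eq, tr_ball]

theorem Good.tr {ν : Measure (E 4)} {η R : ℝ} (h : Good ν η R) {y : E 4} (hy : y ∈ msupp ν)
    (hyR : ‖y‖ ≤ R / 2) : Good (tr ν y) η (R / 2) := by
  have := h.lf
  have hR := h.Rpos
  refine ⟨?_, ?_, by linarith, h.eta, ?_⟩
  · refine ⟨fun x => ⟨closedBall x 1, closedBall_mem_nhds x one_pos, ?_⟩⟩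
    rw [tr_ball]
    exact measure_closedBall_lt_top
  · rw [mem_msupp_tr]; simpa using hy
  · intro x hx hxR t ht htR
    rw [mem_msupp_tr] at hx
    have := h.dens _ hx ((norm_add_le _ _).trans (by linarith)) t ht (by linarith)
    simpa only [Measure.real, tr_ball] using this

section
variable {ν : Measure (E 4)} {η R : ℝ}

theorem Good.up (h : Good ν η R) {x : E 4} (hx : x ∈ msupp ν) (hxR : ‖x‖ ≤ R) {t : ℝ} (ht : 0 < t)
    (htR : t ≤ R) : ν.real (closedBall x t) ≤ 2 * t ^ 3 := by
  have h1 := abs_le.1 (h.dens x hx hxR t ht htR)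
  have : 0 < t ^ 3 := by positivity
  nlinarith [h.eta]

theorem Good.lo (h : Good ν η R) {x : E 4} (hx : x ∈ msupp ν) (hxR : ‖x‖ ≤ R) {t : ℝ} (ht : 0 < t)
    (htR : t ≤ R) : t ^ 3 / 2 ≤ ν.real (closedBall x t) := by
  have h1 := abs_le.1 (h.dens x hx hxR t ht htR)
  have : 0 < t ^ 3 := by positivity
  nlinarith [h.eta]

theorem Good.up0 (h : Good ν η R) {t : ℝ} (ht : 0 < t)
    (htR : t ≤ R) : ν.real (closedBall 0 t) ≤ 2 * t ^ 3 :=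
  h.up h.zero (by simpa using h.Rpos.le) ht htR

theorem Good.lo0 (h : Good ν η R) {t : ℝ} (ht : 0 < t)
    (htR : t ≤ R) : t ^ 3 / 2 ≤ ν.real (closedBall 0 t) :=
  h.lo h.zero (by simpa using h.Rpos.le) ht htR

theorem Good.fin (h : Good ν η R) (x : E 4) (t : ℝ) : ν (closedBall x t) < ∞ := by
  have := h.lf
  exact measure_closedBall_lt_top

theorem Good.int (h : Good ν η R) {F : Type*} [NormedAddCommGroup F] {f : E 4 → F}
    (hf : Continuous f) (x : E 4) (t : ℝ) : IntegrableOn f (closedBall x t) ν := by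
  have := h.lf
  exact hf.continuousOn.integrableOn_compact (isCompact_closedBall x t)

/-- pointwise bound on support gives integral bound -/
theorem Good.int_le (h : Good ν η R) {f g : E 4 → ℝ}
    (hf : Continuous f) (hg : Continuous g) (t : ℝ)
    (hfg : ∀ x ∈ msupp ν, ‖x‖ ≤ t → f x ≤ g x) :
    ∫ w in closedBall 0 t, f w ∂ν ≤ ∫ w in closedBall 0 t, g w ∂ν := by
  refine integral_mono_ae (h.int hf 0 t) (h.int hg 0 t) ?_
  filter_upwards [ae_restrict_of_ae (msupp_ae ν), ae_restrict_mem measurableSet_closedBall]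
    with x hx hxt
  exact hfg x hx (by simpa using hxt)

theorem Good.int_const (t c : ℝ) :
    ∫ _ in closedBall (0 : E 4) t, c ∂ν = ν.real (closedBall 0 t) * c := by
  simp

end


theorem layer_gen {ν : Measure (E 4)} {η u0 : ℝ} {f : E 4 → ℝ} (hf : Integrable f ν)
    (h0 : ∀ w, 0 ≤ f w) (hfin : ∀ u, 0 < u → ν {w | u ≤ f w} < ∞) {g : ℝ → ℝ}
    (hg : IntegrableOn g (Ioi 0))
    (hfg : ∀ u, 0 < u → u ≠ u0 → |ν.real {w | u ≤ f w} - g u| ≤ η * g u) :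
    |∫ w, f w ∂ν - ∫ u in Ioi 0, g u| ≤ η * ∫ u in Ioi 0, g u := by
  rw [hf.integral_eq_integral_meas_le (Eventually.of_forall h0)]
  have hae : ∀ᵐ u ∂(volume.restrict (Ioi (0:ℝ))), |ν.real {w | u ≤ f w} - g u| ≤ η * g u := by
    filter_upwards [ae_restrict_mem measurableSet_Ioi,
      ae_restrict_of_ae (Measure.ae_ne volume u0)] with u hu hu0
    exact hfg u hu hu0
  have hanti : AntitoneOn (fun u => ν.real {w | u ≤ f w}) (Ioi 0) := by
    intro a ha b hb hab
    exact measureReal_mono (fun w hw => le_trans hab hw) (hfin a ha).ne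
  have hmeas : AEStronglyMeasurable (fun u => ν.real {w | u ≤ f w}) (volume.restrict (Ioi (0:ℝ))) :=
    (aemeasurable_restrict_of_antitoneOn measurableSet_Ioi hanti).aestronglyMeasurable
  have hd : IntegrableOn (fun u => ν.real {w | u ≤ f w} - g u) (Ioi 0) := by
    refine Integrable.mono' (hg.const_mul η) (hmeas.sub hg.aestronglyMeasurable) ?_
    simpa [Real.norm_eq_abs] using hae
  have hi : IntegrableOn (fun u => ν.real {w | u ≤ f w}) (Ioi 0) := by
    have := hd.add hg
    refine this.congr (Eventually.of_forall fun u => by simp)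
  rw [← integral_sub hi hg, ← integral_const_mul]
  refine (abs_integral_le_integral_abs).trans ?_
  exact integral_mono_ae hd.abs (hg.const_mul η) hae

/-- cut-off -/
def cut (r : ℝ) (x w : E 4) : ℝ := max 0 (r ^ 2 - ‖w - x‖ ^ 2)

theorem cut_cont (r : ℝ) (x : E 4) : Continuous (cut r x) := by unfold cut; fun_prop

theorem cut_nonneg (r : ℝ) (x w : E 4) : 0 ≤ cut r x w := le_max_left _ _

theorem cut_zero {r : ℝ} (hr : 0 < r) {x w : E 4} (h : w ∉ closedBall x r) : cut r x w = 0 := by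
  simp only [mem_closedBall, dist_eq_norm, not_le] at h
  unfold cut
  rw [max_eq_left]; nlinarith

theorem cut_eq {r : ℝ} {x w : E 4} (h : w ∈ closedBall x r) :
    cut r x w = r ^ 2 - ‖w - x‖ ^ 2 := by
  simp only [mem_closedBall, dist_eq_norm] at h
  unfold cut
  rw [max_eq_right]; nlinarith [norm_nonneg (w - x)]

theorem le_cut {r u : ℝ} (hu : 0 < u) (hur : u ≤ r ^ 2) (x : E 4) :
    {w | u ≤ cut r x w} = closedBall x (√(r ^ 2 - u)) := by
  ext w
  simp only [mem_ofPred_eq, mem_closedBall, dist_eq_norm, cut, le_max_iff, not_le.2 hu, false_or]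
  rw [Real.le_sqrt (norm_nonneg _) (by linarith)]
  constructor <;> intro h <;> linarith

theorem le_cut' {r u : ℝ} (hu : 0 < u) (hur : r ^ 2 < u) (x : E 4) :
    {w | u ≤ cut r x w} = ∅ := by
  ext w
  simp only [mem_ofPred_eq, cut, le_max_iff, not_le.2 hu, false_or, mem_empty_iff_false, iff_false]
  nlinarith [sq_nonneg ‖w - x‖]

theorem Good.supp_int {ν : Measure (E 4)} {η R : ℝ} (h : Good ν η R) {F : Type*}
    [NormedAddCommGroup F] {f : E 4 → F} (hf : Continuous f) {x : E 4}
    {t : ℝ} (hz : ∀ w, w ∉ closedBall x t → f w = 0) : Integrable f ν :=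
  (integrableOn_iff_integrable_of_support_subset (fun w hw => by
    by_contra hc; exact hw (hz w hc))).1 (h.int hf x t)

theorem Good.meas_cut {ν : Measure (E 4)} {η R : ℝ} (h : Good ν η R) {x : E 4} (hx : x ∈ msupp ν)
    (hxR : ‖x‖ ≤ R) {r : ℝ} (hr : 0 < r) (hrR : r ≤ R) {u : ℝ} (hu : 0 < u) (hu0 : u ≠ r ^ 2) :
    |ν.real {w | u ≤ cut r x w} - √(r ^ 2 - u) ^ 3| ≤ η * √(r ^ 2 - u) ^ 3 := by
  rcases lt_or_gt_of_ne hu0 with h1 | h1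
  · rw [le_cut hu h1.le]
    refine h.dens x hx hxR _ (Real.sqrt_pos.2 (by linarith)) ?_
    rw [Real.sqrt_le_left (by linarith)]; nlinarith
  · rw [le_cut' hu h1, Real.sqrt_eq_zero_of_nonpos (by linarith)]; simp

theorem g_int {r : ℝ} (g : ℝ → ℝ) (hg : Continuous g) {b : ℝ} (hb : ∀ u, b < u → g u = 0) :
    IntegrableOn g (Ioi 0) := by
  have h1 : IntegrableOn g (Icc 0 b) := hg.continuousOn.integrableOn_compact isCompact_Icc
  have h2 : IntegrableOn g (Ioi b) := by
    refine (integrableOn_zero).congr_fun (fun u hu => (hb u hu).symm) measurableSet_Ioi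
  refine (h1.union h2).mono_set ?_
  intro u hu
  rcases le_or_gt u b with h | h
  · exact Or.inl ⟨hu.le, h⟩
  · exact Or.inr h

theorem g1_val {r : ℝ} (hr : 0 < r) : ∫ u in Ioi 0, √(r ^ 2 - u) ^ 3 = 2 / 5 * r ^ 5 := by
  have h1 : ∫ u in Ioi 0, √(r ^ 2 - u) ^ 3 = ∫ u in Ioc 0 (r ^ 2), √(r ^ 2 - u) ^ 3 := by
    refine setIntegral_eq_of_subset_of_forall_diff_eq_zero measurableSet_Ioi
      (fun u hu => hu.1) ?_
    intro u hu
    have : r ^ 2 < u := by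
      by_contra hc; exact hu.2 ⟨hu.1, not_lt.1 hc⟩
    rw [Real.sqrt_eq_zero_of_nonpos (by linarith)]; simp
  rw [h1, ← intervalIntegral.integral_of_le (by positivity)]
  rw [intervalIntegral.integral_comp_sub_left (fun v => √v ^ 3)]
  have h2 : ∀ v : ℝ, v ∈ uIcc (r ^ 2 - r ^ 2) (r ^ 2 - 0) → √v ^ 3 = v ^ (3 / 2 : ℝ) := by
    intro v hv
    have hv0 : 0 ≤ v := by
      rw [uIcc_of_le (by nlinarith)] at hv; linarith [hv.1]
    rw [Real.sqrt_eq_rpow, ← Real.rpow_natCast, ← Real.rpow_mul hv0]; norm_num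
  rw [intervalIntegral.integral_congr h2, integral_rpow (Or.inl (by norm_num))]
  simp only [sub_self, sub_zero]
  rw [Real.zero_rpow (by norm_num), ← Real.rpow_natCast r 2, ← Real.rpow_mul hr.le]
  norm_num
  ring

theorem Good.I1 {ν : Measure (E 4)} {η R : ℝ} (h : Good ν η R) {r : ℝ} (hr : 0 < r) (hrR : r ≤ R) :
    |∫ w in closedBall 0 r, (r ^ 2 - ‖w‖ ^ 2) ∂ν - 2 / 5 * r ^ 5| ≤ η * (2 / 5 * r ^ 5) := by
  have h1 : ∫ w in closedBall 0 r, (r ^ 2 - ‖w‖ ^ 2) ∂ν = ∫ w, cut r 0 w ∂ν := by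
    rw [← setIntegral_eq_integral_of_forall_compl_eq_zero (s := closedBall 0 r)
      (fun w hw => cut_zero hr hw)]
    refine setIntegral_congr_fun measurableSet_closedBall (fun w hw => ?_)
    rw [cut_eq hw, sub_zero]
  rw [h1, ← g1_val hr]
  refine layer_gen (u0 := r ^ 2) (h.supp_int (cut_cont r 0) (fun w hw => cut_zero hr hw))
    (cut_nonneg r 0) ?_ (g_int (r := r) _ (by fun_prop) (b := r ^ 2) ?_) ?_
  · intro u hu
    rcases le_or_gt u (r ^ 2) with h2 | h2
    · rw [le_cut hu h2]; exact h.fin _ _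
    · rw [le_cut' hu h2]; simp
  · intro u hu
    rw [Real.sqrt_eq_zero_of_nonpos (by linarith)]; simp
  · intro u hu hu0
    exact h.meas_cut h.zero (by simpa using h.Rpos.le) hr hrR hu hu0

theorem Good.I2 {r : ℝ} (hr : 0 < r) : ∃ K : ℝ, 0 ≤ K ∧ K ≤ r ^ 7 ∧
    ∀ {ν : Measure (E 4)} {η R : ℝ}, Good ν η R → ∀ x ∈ msupp ν, ‖x‖ ≤ R → r ≤ R → 
    |∫ w, cut r x w ^ 2 ∂ν - K| ≤ η * K := by
  refine ⟨∫ u in Ioi 0, √(r ^ 2 - √u) ^ 3, ?_, ?_, ?_⟩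
  · exact setIntegral_nonneg measurableSet_Ioi (fun u hu => by positivity)
  · have h1 : ∫ u in Ioi 0, √(r ^ 2 - √u) ^ 3 = ∫ u in Ioc 0 (r ^ 4), √(r ^ 2 - √u) ^ 3 := by
      refine setIntegral_eq_of_subset_of_forall_diff_eq_zero measurableSet_Ioi
        (fun u hu => hu.1) ?_
      intro u hu
      have h3 : r ^ 4 < u := by
        by_contra hc; exact hu.2 ⟨hu.1, not_lt.1 hc⟩
      have : r ^ 2 ≤ √u := Real.le_sqrt_of_sq_le (by nlinarith)
      rw [Real.sqrt_eq_zero_of_nonpos (by linarith)]; simp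
    rw [h1]
    have h2 : ∫ u in Ioc 0 (r ^ 4), √(r ^ 2 - √u) ^ 3 ≤ ∫ u in Ioc 0 (r ^ 4), r ^ 3 := by
      refine setIntegral_mono_on ?_ (by simp) measurableSet_Ioc ?_
      · exact ((by fun_prop : Continuous fun u : ℝ => √(r ^ 2 - √u) ^ 3).continuousOn.integrableOn_compact
          isCompact_Icc).mono_set Ioc_subset_Icc_self
      · intro u hu
        gcongr
        rw [Real.sqrt_le_left hr.le]
        nlinarith [Real.sqrt_nonneg u]
    refine h2.trans (le_of_eq ?_)
    rw [setIntegral_const, Measure.real, Real.volume_Ioc, ENNReal.toReal_ofReal (by simp; positivity)]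
    simp; ring
  · intro ν η R h x hx hxR hrR
    have hset : ∀ u, 0 < u → {w | u ≤ cut r x w ^ 2} = {w | √u ≤ cut r x w} := by
      intro u hu
      ext w
      simp only [mem_ofPred_eq]
      rw [Real.sqrt_le_left (cut_nonneg r x w)]
    refine layer_gen (f := fun w => cut r x w ^ 2) (u0 := r ^ 4) (h.supp_int (x := x) (t := r) ((cut_cont r x).pow 2) (fun w hw => by
        change cut r x w ^ 2 = 0; rw [cut_zero hr hw]; simp))
      (fun w => sq_nonneg _) ?_ (g_int (r := r) _ (by fun_prop) (b := r ^ 4) ?_) ?_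
    · intro u hu
      rw [hset u hu]
      rcases le_or_gt (√u) (r ^ 2) with h2 | h2
      · rw [le_cut (Real.sqrt_pos.2 hu) h2]; exact h.fin _ _
      · rw [le_cut' (Real.sqrt_pos.2 hu) h2]; simp
    · intro u hu
      have : r ^ 2 ≤ √u := Real.le_sqrt_of_sq_le (by nlinarith)
      rw [Real.sqrt_eq_zero_of_nonpos (by linarith)]; simp
    · intro u hu hu0
      rw [hset u hu]
      refine h.meas_cut hx hxR hr hrR (Real.sqrt_pos.2 hu) ?_
      intro hc
      apply hu0
      rw [← Real.sq_sqrt hu.le, hc]; ring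


/-- normalized second moment -/
def QQ (ν : Measure (E 4)) (r : ℝ) (v : E 4) : ℝ :=
  5 / r ^ 5 * ∫ w in closedBall (0 : E 4) r, ⟪v, w⟫ ^ 2 ∂ν

/-- normalized first moment -/
def bet (ν : Measure (E 4)) (r : ℝ) : E 4 :=
  (5 / r ^ 5) • ∫ w in closedBall (0 : E 4) r, (r ^ 2 - ‖w‖ ^ 2) • w ∂ν

theorem Good.inner_bet {ν : Measure (E 4)} {η R : ℝ} (h : Good ν η R) (r : ℝ) (x : E 4) :
    ⟪bet ν r, x⟫ = 5 / r ^ 5 * ∫ w in closedBall (0 : E 4) r, (r ^ 2 - ‖w‖ ^ 2) * ⟪x, w⟫ ∂ν := by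
  rw [bet, real_inner_smul_left, real_inner_comm, ← integral_inner (h.int (by fun_prop) 0 r)]
  simp only [real_inner_smul_right]

theorem cut_point {r : ℝ} (hr : 0 < r) {x : E 4} (hx : ‖x‖ ≤ r / 2) (w : E 4) :
    |cut r x w ^ 2 - cut r 0 w ^ 2 - (closedBall (0 : E 4) r).indicator (fun w =>
      2 * (r ^ 2 - ‖w‖ ^ 2) * (2 * ⟪x, w⟫ - ‖x‖ ^ 2) + (2 * ⟪x, w⟫ - ‖x‖ ^ 2) ^ 2) w| ≤
    (closedBall (0 : E 4) (r + ‖x‖) \ closedBall 0 (r - ‖x‖)).indicator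
      (fun _ => 13 * r ^ 2 * ‖x‖ ^ 2) w := by
  have hd := norm_nonneg x
  have hn : ‖w - x‖ ^ 2 = ‖w‖ ^ 2 - 2 * ⟪x, w⟫ + ‖x‖ ^ 2 := by
    rw [norm_sub_sq_real, real_inner_comm]
  have hb : w ∈ closedBall (0 : E 4) (r + ‖x‖) →
      (2 * ⟪x, w⟫ - ‖x‖ ^ 2) ^ 2 ≤ 13 * r ^ 2 * ‖x‖ ^ 2 := by
    intro hw
    have hw' : ‖w‖ ≤ r + ‖x‖ := by simpa using hw
    have h1 : |⟪x, w⟫| ≤ ‖x‖ * (r + ‖x‖) :=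
      (abs_real_inner_le_norm x w).trans (by gcongr)
    have h2 : |2 * ⟪x, w⟫ - ‖x‖ ^ 2| ≤ 3.5 * (r * ‖x‖) := by
      rw [abs_le] at h1 ⊢
      constructor <;> nlinarith
    have h3 := sq_le_sq' (abs_le.1 h2).1 (abs_le.1 h2).2
    have : 0 ≤ (r * ‖x‖) ^ 2 := by positivity
    nlinarith
  by_cases h1 : w ∈ closedBall (0 : E 4) r <;> by_cases h2 : w ∈ closedBall x r
  · rw [indicator_of_mem h1, cut_eq h1, cut_eq h2, sub_zero, hn]
    rw [show ∀ A B D : ℝ, (A - (B - 2 * D + ‖x‖ ^ 2)) ^ 2 - (A - B) ^ 2 -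
      (2 * (A - B) * (2 * D - ‖x‖ ^ 2) + (2 * D - ‖x‖ ^ 2) ^ 2) = 0 by intros; ring]
    rw [abs_zero]
    exact indicator_nonneg (fun _ _ => by positivity) _
  · have h3 : w ∈ closedBall (0 : E 4) (r + ‖x‖) \ closedBall 0 (r - ‖x‖) := by
      refine ⟨closedBall_subset_closedBall (by linarith) h1, fun hc => h2 ?_⟩
      simp only [mem_closedBall, dist_eq_norm, sub_zero] at hc ⊢
      linarith [norm_sub_le w x]
    rw [indicator_of_mem h1, indicator_of_mem h3, cut_eq h1, cut_zero hr h2, sub_zero]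
    refine le_trans ?_ (hb h3.1)
    simp only [mem_closedBall, dist_eq_norm, sub_zero, not_le] at h1 h2
    have h4 : r ^ 2 - ‖w‖ ^ 2 + (2 * ⟪x, w⟫ - ‖x‖ ^ 2) ≤ 0 := by nlinarith
    have h5 : 0 ≤ r ^ 2 - ‖w‖ ^ 2 := by nlinarith [norm_nonneg w]
    rw [abs_le]; constructor <;> nlinarith
  · have h3 : w ∈ closedBall (0 : E 4) (r + ‖x‖) \ closedBall 0 (r - ‖x‖) := by
      refine ⟨?_, fun hc => h1 (closedBall_subset_closedBall (by linarith) hc)⟩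
      simp only [mem_closedBall, dist_eq_norm, sub_zero] at h2 ⊢
      have := norm_add_le (w - x) x
      rw [sub_add_cancel] at this
      linarith
    rw [indicator_of_notMem h1, indicator_of_mem h3, cut_eq h2, cut_zero hr h1, hn]
    refine le_trans ?_ (hb h3.1)
    simp only [mem_closedBall, dist_eq_norm, sub_zero, not_le] at h1 h2
    have h4 : 0 ≤ r ^ 2 - ‖w‖ ^ 2 + (2 * ⟪x, w⟫ - ‖x‖ ^ 2) := by nlinarith [norm_nonneg (w - x)]
    have h5 : r ^ 2 - ‖w‖ ^ 2 ≤ 0 := by nlinarith [norm_nonneg w]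
    rw [abs_le]; constructor <;> nlinarith
  · rw [indicator_of_notMem h1, cut_zero hr h1, cut_zero hr h2]
    simp only [ne_eq, OfNat.ofNat_ne_zero, not_false_eq_true, zero_pow, sub_self, abs_zero]
    exact indicator_nonneg (fun _ _ => by positivity) _

set_option maxHeartbeats 1000000 in
theorem Good.star {ν : Measure (E 4)} {η R : ℝ} (h : Good ν η R) {r : ℝ} (hr : 0 < r)
    (hrR : 2 * r ≤ R) {x : E 4} (hx : x ∈ msupp ν) (hxr : ‖x‖ ≤ r / 2) :
    |⟪bet ν r, x⟫ + QQ ν r x - ‖x‖ ^ 2| ≤ 120 * (‖x‖ ^ 3 / r + η * r ^ 2) := by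
  have hd := norm_nonneg x
  have hη := h.eta0
  have hη1 := h.eta
  obtain ⟨K, hK0, hK1, hK⟩ := Good.I2 hr
  have hKx := hK h x hx (by linarith) (by linarith)
  have hK0 := hK h 0 h.zero (by simpa using h.Rpos.le) (by linarith)
  have i1 : Integrable (fun w => cut r x w ^ 2) ν :=
    h.supp_int (x := x) (t := r) ((cut_cont r x).pow 2)
      (fun w hw => by change cut r x w ^ 2 = 0; rw [cut_zero hr hw]; simp)
  have i2 : Integrable (fun w => cut r 0 w ^ 2) ν :=
    h.supp_int (x := 0) (t := r) ((cut_cont r 0).pow 2)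
      (fun w hw => by change cut r 0 w ^ 2 = 0; rw [cut_zero hr hw]; simp)
  set f : E 4 → ℝ := fun w => 2 * (r ^ 2 - ‖w‖ ^ 2) * (2 * ⟪x, w⟫ - ‖x‖ ^ 2) +
    (2 * ⟪x, w⟫ - ‖x‖ ^ 2) ^ 2 with hf
  have fc : Continuous f := by fun_prop
  have i3 : Integrable ((closedBall (0 : E 4) r).indicator f) ν :=
    (h.int fc 0 r).integrable_indicator measurableSet_closedBall
  set L := closedBall (0 : E 4) (r + ‖x‖) \ closedBall 0 (r - ‖x‖) with hL
  have mL : MeasurableSet L := measurableSet_closedBall.diff measurableSet_closedBall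
  have fL : ν L < ∞ := (measure_mono sdiff_subset).trans_lt (h.fin 0 (r + ‖x‖))
  have i4 : Integrable (L.indicator (fun _ => 13 * r ^ 2 * ‖x‖ ^ 2)) ν :=
    (integrableOn_const (hs := fL.ne)).integrable_indicator mL
  have vL : ν.real L ≤ 6.5 * r ^ 2 * ‖x‖ + 4.4 * η * r ^ 3 := by
    rw [hL, measureReal_sdiff (closedBall_subset_closedBall (by linarith))
      measurableSet_closedBall (h.fin _ _).ne]
    have h1 := abs_le.1 (h.dens 0 h.zero (by simpa using h.Rpos.le) (r + ‖x‖) (by linarith)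
      (by linarith))
    have h2 := abs_le.1 (h.dens 0 h.zero (by simpa using h.Rpos.le) (r - ‖x‖) (by linarith)
      (by linarith))
    have h3 : (r + ‖x‖) ^ 3 ≤ 3.375 * r ^ 3 := by
      have := pow_le_pow_left₀ (by linarith) (by linarith : r + ‖x‖ ≤ 1.5 * r) 3
      linarith [mul_pow 1.5 r 3]
    have h4 : (r - ‖x‖) ^ 3 ≤ r ^ 3 := pow_le_pow_left₀ (by linarith) (by linarith) 3
    have h5 : (r + ‖x‖) ^ 3 - (r - ‖x‖) ^ 3 ≤ 6.5 * r ^ 2 * ‖x‖ := by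
      have : ‖x‖ ^ 2 ≤ (r / 2) ^ 2 := pow_le_pow_left₀ hd hxr 2
      nlinarith
    have hr3 : 0 < r ^ 3 := by positivity
    nlinarith
  have err : |∫ w, cut r x w ^ 2 ∂ν - ∫ w, cut r 0 w ^ 2 ∂ν - ∫ w in closedBall (0 : E 4) r, f w ∂ν|
      ≤ ν.real L * (13 * r ^ 2 * ‖x‖ ^ 2) := by
    have i12 : Integrable (fun w => cut r x w ^ 2 - cut r 0 w ^ 2) ν := i1.sub i2
    rw [← integral_indicator measurableSet_closedBall, ← integral_sub i1 i2,
      ← integral_sub i12 i3]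
    refine abs_integral_le_integral_abs.trans ?_
    refine (integral_mono ((i1.sub i2).sub i3).abs i4 (fun w => cut_point hr hxr w)).trans ?_
    rw [integral_indicator mL, setIntegral_const, smul_eq_mul]
  have I1 := h.I1 hr (by linarith)
  set A := ∫ w in closedBall (0 : E 4) r, (r ^ 2 - ‖w‖ ^ 2) ∂ν with hA
  set B := ∫ w in closedBall (0 : E 4) r, (r ^ 2 - ‖w‖ ^ 2) * ⟪x, w⟫ ∂ν with hB
  set D := ∫ w in closedBall (0 : E 4) r, ⟪x, w⟫ ∂ν with hD
  set G := ∫ w in closedBall (0 : E 4) r, ⟪x, w⟫ ^ 2 ∂ν with hG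
  have ef : ∫ w in closedBall (0 : E 4) r, f w ∂ν = 4 * B - 2 * ‖x‖ ^ 2 * A + 4 * G
      - 4 * ‖x‖ ^ 2 * D + ‖x‖ ^ 4 * ν.real (closedBall 0 r) := by
    have : f = fun w => 4 * ((r ^ 2 - ‖w‖ ^ 2) * ⟪x, w⟫) - 2 * ‖x‖ ^ 2 * (r ^ 2 - ‖w‖ ^ 2)
       + 4 * ⟪x, w⟫ ^ 2 - 4 * ‖x‖ ^ 2 * ⟪x, w⟫ + ‖x‖ ^ 4 := by
      funext w; simp only [hf]; ring
    rw [this]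
    rw [integral_add (h.int (by fun_prop) 0 r) (h.int (by fun_prop) 0 r),
      integral_sub (h.int (by fun_prop) 0 r) (h.int (by fun_prop) 0 r),
      integral_add (h.int (by fun_prop) 0 r) (h.int (by fun_prop) 0 r),
      integral_sub (h.int (by fun_prop) 0 r) (h.int (by fun_prop) 0 r)]
    simp only [integral_const_mul, setIntegral_const, smul_eq_mul]
    ring
  have hm := h.up0 hr (by linarith)
  have hDb : |D| ≤ 2 * r ^ 3 * (‖x‖ * r) := by
    have : |D| ≤ ‖x‖ * r * ν.real (closedBall 0 r) := by
      rw [← Real.norm_eq_abs]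
      refine norm_setIntegral_le_of_norm_le_const (h.fin 0 r) (fun w hw => ?_)
      have hw' : ‖w‖ ≤ r := by simpa using hw
      rw [Real.norm_eq_abs]
      exact (abs_real_inner_le_norm x w).trans (by gcongr)
    have h0 : 0 ≤ ‖x‖ * r := by positivity
    nlinarith
  have e1 : ⟪bet ν r, x⟫ + QQ ν r x - ‖x‖ ^ 2 = 5 / 4 / r ^ 5 * (4 * B + 4 * G - 4 / 5 * r ^ 5 * ‖x‖ ^ 2) := by
    rw [h.inner_bet, QQ, ← hB, ← hG]; field_simp
  rw [e1, abs_mul, abs_of_pos (by positivity : 0 < 5 / 4 / r ^ 5)]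
  have key : |4 * B + 4 * G - 4 / 5 * r ^ 5 * ‖x‖ ^ 2| ≤ 94 * r ^ 4 * ‖x‖ ^ 3 + 17 * η * r ^ 7 := by
    rw [ef] at err
    have e2 : ν.real L * (13 * r ^ 2 * ‖x‖ ^ 2) ≤ 84.5 * r ^ 4 * ‖x‖ ^ 3 + 14.3 * η * r ^ 7 := by
      have h1 := mul_le_mul_of_nonneg_right vL (by positivity : 0 ≤ 13 * r ^ 2 * ‖x‖ ^ 2)
      have h2 : ‖x‖ ^ 2 ≤ (r / 2) ^ 2 := pow_le_pow_left₀ hd hxr 2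
      have h3 := mul_le_mul_of_nonneg_left h2 (by positivity : 0 ≤ 57.2 * η * r ^ 5)
      nlinarith
    have e3 : |2 * ‖x‖ ^ 2 * (A - 2 / 5 * r ^ 5)| ≤ 0.2 * η * r ^ 7 := by
      rw [abs_mul, abs_of_nonneg (by positivity)]
      have h2 : ‖x‖ ^ 2 ≤ (r / 2) ^ 2 := pow_le_pow_left₀ hd hxr 2
      calc 2 * ‖x‖ ^ 2 * |A - 2 / 5 * r ^ 5| ≤ 2 * (r / 2) ^ 2 * (η * (2 / 5 * r ^ 5)) := by gcongr
        _ = 0.2 * η * r ^ 7 := by ring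
    have e4 : |4 * ‖x‖ ^ 2 * D| ≤ 8 * r ^ 4 * ‖x‖ ^ 3 := by
      rw [abs_mul, abs_of_nonneg (by positivity)]
      calc 4 * ‖x‖ ^ 2 * |D| ≤ 4 * ‖x‖ ^ 2 * (2 * r ^ 3 * (‖x‖ * r)) := by gcongr
        _ = _ := by ring
    have e5 : ‖x‖ ^ 4 * ν.real (closedBall 0 r) ≤ r ^ 4 * ‖x‖ ^ 3 := by
      calc ‖x‖ ^ 4 * ν.real (closedBall 0 r) ≤ ‖x‖ ^ 4 * (2 * r ^ 3) := by gcongr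
        _ = ‖x‖ ^ 3 * (2 * r ^ 3) * ‖x‖ := by ring
        _ ≤ ‖x‖ ^ 3 * (2 * r ^ 3) * (r / 2) := by gcongr
        _ = _ := by ring
    have e5' : 0 ≤ ‖x‖ ^ 4 * ν.real (closedBall 0 r) := by positivity
    have e6 : η * K ≤ η * r ^ 7 := by gcongr
    have e7 : 0 ≤ r ^ 4 * ‖x‖ ^ 3 := by positivity
    have e8 : 0 ≤ η * r ^ 7 := by positivity
    obtain ⟨a1, b1⟩ := abs_le.1 err
    obtain ⟨a2, b2⟩ := abs_le.1 hKx
    obtain ⟨a3, b3⟩ := abs_le.1 hK0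
    obtain ⟨a4, b4⟩ := abs_le.1 e3
    obtain ⟨a5, b5⟩ := abs_le.1 e4
    clear_value A B D G L f
    clear hK hKx hK0 err e3 e4 i1 i2 i3 i4 I1 ef hDb
    rw [abs_le]
    constructor <;> linarith
  calc 5 / 4 / r ^ 5 * |4 * B + 4 * G - 4 / 5 * r ^ 5 * ‖x‖ ^ 2|
      ≤ 5 / 4 / r ^ 5 * (94 * r ^ 4 * ‖x‖ ^ 3 + 17 * η * r ^ 7) := by gcongr
    _ = 117.5 * (‖x‖ ^ 3 / r) + 21.25 * (η * r ^ 2) := by field_simp; ring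
    _ ≤ _ := by
      have : 0 ≤ ‖x‖ ^ 3 / r := by positivity
      have : 0 ≤ η * r ^ 2 := by positivity
      linarith

theorem Good.trace {ν : Measure (E 4)} {η R : ℝ} (h : Good ν η R) {r : ℝ} (hr : 0 < r)
    (hrR : r ≤ R) (e : OrthonormalBasis (Fin 4) ℝ (E 4)) :
    |∑ i, QQ ν r (e i) - 3| ≤ 7 * η := by
  have h1 : ∑ i, QQ ν r (e i) = 5 / r ^ 5 * ∫ w in closedBall (0 : E 4) r, ‖w‖ ^ 2 ∂ν := by
    simp only [QQ]
    rw [← Finset.mul_sum, ← integral_finsetSum _ (fun i _ => h.int (by fun_prop) 0 r)]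
    congr 2
    funext w
    rw [← e.sum_sq_norm_inner_right w]
    simp
  have h2 : ∫ w in closedBall (0 : E 4) r, ‖w‖ ^ 2 ∂ν = r ^ 2 * ν.real (closedBall 0 r)
      - ∫ w in closedBall (0 : E 4) r, (r ^ 2 - ‖w‖ ^ 2) ∂ν := by
    rw [integral_sub (h.int (by fun_prop) 0 r) (h.int (by fun_prop) 0 r), setIntegral_const,
      smul_eq_mul]
    ring
  have h3 := h.dens 0 h.zero (by simpa using h.Rpos.le) r hr hrR
  have h4 := h.I1 hr hrR
  rw [h1, h2]
  set V := ν.real (closedBall 0 r)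
  set A := ∫ w in closedBall (0 : E 4) r, (r ^ 2 - ‖w‖ ^ 2) ∂ν
  have : 5 / r ^ 5 * (r ^ 2 * V - A) - 3 = 5 / r ^ 5 * (r ^ 2 * (V - r ^ 3) - (A - 2 / 5 * r ^ 5)) := by
    field_simp; ring
  rw [this, abs_mul, abs_of_pos (by positivity)]
  calc 5 / r ^ 5 * |r ^ 2 * (V - r ^ 3) - (A - 2 / 5 * r ^ 5)|
      ≤ 5 / r ^ 5 * (r ^ 2 * (η * r ^ 3) + η * (2 / 5 * r ^ 5)) := by
        gcongr
        refine (abs_sub _ _).trans ?_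
        rw [abs_mul, abs_of_pos (by positivity : 0 < r ^ 2)]
        gcongr
    _ = 7 * η := by field_simp; ring

/-- basic bounds -/
theorem Good.QQ_nonneg {ν : Measure (E 4)} {r : ℝ} (hr : 0 < r) (v : E 4) : 0 ≤ QQ ν r v := by
  unfold QQ
  have : 0 ≤ ∫ w in closedBall (0 : E 4) r, ⟪v, w⟫ ^ 2 ∂ν := integral_nonneg (fun w => sq_nonneg _)
  positivity

theorem Good.QQ_strip {ν : Measure (E 4)} {η R : ℝ} (h : Good ν η R) {r : ℝ} (hr : 0 < r)
    (hrR : r ≤ R) {v : E 4} {c : ℝ} (hs : ∀ x ∈ msupp ν, ‖x‖ ≤ r → |⟪v, x⟫| ≤ c * r) :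
    QQ ν r v ≤ 10 * c ^ 2 := by
  have h1 : ∫ w in closedBall (0 : E 4) r, ⟪v, w⟫ ^ 2 ∂ν ≤ ∫ w in closedBall (0 : E 4) r, (c * r) ^ 2 ∂ν :=
    h.int_le (by fun_prop) (by fun_prop) r (fun x hx hxr => sq_le_sq' (abs_le.1 (hs x hx hxr)).1
      (abs_le.1 (hs x hx hxr)).2)
  rw [Good.int_const] at h1
  have h2 := h.up0 hr hrR
  calc QQ ν r v ≤ 5 / r ^ 5 * (2 * r ^ 3 * (c * r) ^ 2) := by
        unfold QQ
        gcongr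
        exact h1.trans (by gcongr)
    _ = _ := by field_simp; ring

theorem Good.bet_strip {ν : Measure (E 4)} {η R : ℝ} (h : Good ν η R) {r : ℝ} (hr : 0 < r)
    (hrR : r ≤ R) {v : E 4} {c : ℝ} (hs : ∀ x ∈ msupp ν, ‖x‖ ≤ r → ⟪v, x⟫ ≤ c * r) (hc : 0 ≤ c) :
    ⟪bet ν r, v⟫ ≤ 10 * c * r := by
  have h1 : ∫ w in closedBall (0 : E 4) r, (r ^ 2 - ‖w‖ ^ 2) * ⟪v, w⟫ ∂ν ≤
      ∫ w in closedBall (0 : E 4) r, r ^ 2 * (c * r) ∂ν :=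
    h.int_le (by fun_prop) (by fun_prop) r (fun x hx hxr => by
      have h3 := hs x hx hxr
      have h4 : 0 ≤ r ^ 2 - ‖x‖ ^ 2 := by nlinarith [norm_nonneg x]
      have h5 : 0 ≤ c * r := by positivity
      nlinarith [sq_nonneg ‖x‖, mul_nonneg (sq_nonneg ‖x‖) h5])
  rw [Good.int_const] at h1
  have h2 := h.up0 hr hrR
  rw [h.inner_bet]
  calc _ ≤ 5 / r ^ 5 * (2 * r ^ 3 * (r ^ 2 * (c * r))) := by
        gcongr
        exact h1.trans (by gcongr)
    _ = _ := by field_simp; ring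

theorem Good.bet_norm {ν : Measure (E 4)} {η R : ℝ} (h : Good ν η R) {r : ℝ} (hr : 0 < r)
    (hrR : r ≤ R) : ‖bet ν r‖ ≤ 10 * r := by
  by_cases hb : bet ν r = 0
  · rw [hb]; simp; positivity
  have hb' : 0 < ‖bet ν r‖ := norm_pos_iff.2 hb
  have := h.bet_strip hr hrR (v := bet ν r) (c := ‖bet ν r‖) (fun x hx hxr =>
    (real_inner_le_norm _ _).trans (by gcongr)) hb'.le
  rw [real_inner_self_eq_norm_sq] at this
  nlinarith


theorem onb1 {n : E 4} (hn : ‖n‖ = 1) : ∃ e : OrthonormalBasis (Fin 4) ℝ (E 4), e 3 = n := by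
  obtain ⟨b, hb⟩ := Orthonormal.exists_orthonormalBasis_extension_of_card_eq (𝕜 := ℝ) (E := E 4)
    (ι := Fin 4) (by simp) (v := fun _ => n) (s := {3}) (by
      rw [orthonormal_iff_ite]
      rintro ⟨i, hi⟩ ⟨j, hj⟩
      simp only [mem_singleton_iff] at hi hj
      subst hi; subst hj
      simp [hn])
  exact ⟨b, hb 3 rfl⟩

theorem onb2 {u v : E 4} (hu : ‖u‖ = 1) (hv : ‖v‖ = 1) (huv : ⟪u, v⟫ = 0) :
    ∃ e : OrthonormalBasis (Fin 4) ℝ (E 4), e 0 = u ∧ e 1 = v := by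
  obtain ⟨b, hb⟩ := Orthonormal.exists_orthonormalBasis_extension_of_card_eq (𝕜 := ℝ) (E := E 4)
    (ι := Fin 4) (by simp) (v := ![u, v, 0, 0]) (s := {0, 1}) (by
      rw [orthonormal_iff_ite]
      rintro ⟨i, hi⟩ ⟨j, hj⟩
      simp only [mem_insert_iff, mem_singleton_iff] at hi hj
      have hvu : ⟪v, u⟫ = 0 := by rw [real_inner_comm]; exact huv
      rcases hi with rfl | rfl <;> rcases hj with rfl | rfl <;> simp [hu, hv, huv, hvu])
  exact ⟨b, hb 0 (by simp), hb 1 (by simp)⟩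

theorem norm_sq_onb (e : OrthonormalBasis (Fin 4) ℝ (E 4)) (x : E 4) :
    ‖x‖ ^ 2 = ⟪e 0, x⟫ ^ 2 + ⟪e 1, x⟫ ^ 2 + ⟪e 2, x⟫ ^ 2 + ⟪e 3, x⟫ ^ 2 := by
  rw [← e.sum_sq_norm_inner_right x]
  simp [Fin.sum_univ_four]

theorem Good.CL0 {ν : Measure (E 4)} {η R : ℝ} (h : Good ν η R) {u v : E 4} (hu : ‖u‖ = 1)
    (hv : ‖v‖ = 1) (huv : ⟪u, v⟫ = 0) {c t : ℝ} (hc : 0 < c) (hc1 : c ≤ 1 / 5) (ht : 0 < t)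
    (htR : t ≤ R) :
    ν.real {w | ‖w‖ ≤ t ∧ |⟪u, w⟫| ≤ c * t ∧ |⟪v, w⟫| ≤ c * t} ≤ 900 * c * t ^ 3 := by
  obtain ⟨e, he0, he1⟩ := onb2 hu hv huv
  have hct : 0 < c * t := by positivity
  set A := {w | ‖w‖ ≤ t ∧ |⟪u, w⟫| ≤ c * t ∧ |⟪v, w⟫| ≤ c * t} with hA
  set N : ℤ := ⌈1 / c⌉ with hN
  have hN1 : (1 / c : ℝ) ≤ N := Int.le_ceil _
  have hN2 : (N : ℝ) ≤ 1 / c + 1 := (Int.ceil_lt_add_one _).le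
  set I : Finset ℤ := Finset.Icc (-N) N with hI
  let f : ℤ × ℤ → Set (E 4) := fun k => {w | w ∈ A ∧ w ∈ msupp ν ∧ ⌊⟪e 2, w⟫ / (c * t)⌋ = k.1 ∧
    ⌊⟪e 3, w⟫ / (c * t)⌋ = k.2}
  have hAb : A ⊆ closedBall 0 t := fun w hw => by simpa using hw.1
  have hcell : ∀ k, ν.real (f k) ≤ 128 * c ^ 3 * t ^ 3 := by
    intro k
    rcases (f k).eq_empty_or_nonempty with h0 | ⟨y, hy⟩
    · rw [h0]; simp; positivity
    have hsub : f k ⊆ closedBall y (4 * (c * t)) := by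
      intro w hw
      rw [mem_closedBall, dist_eq_norm]
      refine abs_le_of_sq_le_sq' ?_ (by positivity) |>.2
      rw [norm_sq_onb e, he0, he1]
      simp only [inner_sub_right]
      have aux : ∀ a b : ℝ, |a| ≤ c * t → |b| ≤ c * t → (a - b) ^ 2 ≤ 4 * (c * t) ^ 2 := by
        intro a b ha hb
        rw [abs_le] at ha hb
        nlinarith
      have aux2 : ∀ a b : ℝ, ⌊a / (c * t)⌋ = ⌊b / (c * t)⌋ → (a - b) ^ 2 ≤ (c * t) ^ 2 := by
        intro a b hab
        have h1 := Int.abs_sub_lt_one_of_floor_eq_floor hab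
        rw [← sub_div, abs_div, abs_of_pos hct, div_lt_one hct] at h1
        exact sq_le_sq' (abs_lt.1 h1).1.le (abs_lt.1 h1).2.le
      have h1 := aux _ _ hw.1.2.1 hy.1.2.1
      have h2 := aux _ _ hw.1.2.2 hy.1.2.2
      have h3 := aux2 _ _ (hw.2.2.1.trans hy.2.2.1.symm)
      have h4 := aux2 _ _ (hw.2.2.2.trans hy.2.2.2.symm)
      nlinarith [sq_nonneg (c * t)]
    refine (measureReal_mono hsub (h.fin _ _).ne).trans ?_
    refine (h.up hy.2.1 (hy.1.1.trans htR) (by positivity) ?_).trans (le_of_eq (by ring))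
    nlinarith
  have hcov : A ∩ msupp ν ⊆ ⋃ k ∈ I ×ˢ I, f k := by
    rintro w ⟨hw, hws⟩
    have aux : ∀ i, ⌊⟪e i, w⟫ / (c * t)⌋ ∈ I := by
      intro i
      have h1 : |⟪e i, w⟫| ≤ t := (abs_real_inner_le_norm _ _).trans (by
        rw [e.orthonormal.1 i]; linarith [hw.1])
      have h2 : |⟪e i, w⟫ / (c * t)| ≤ 1 / c := by
        rw [abs_div, abs_of_pos hct, div_le_div_iff₀ hct hc]
        nlinarith
      rw [abs_le] at h2
      rw [hI, Finset.mem_Icc]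
      constructor
      · rw [Int.le_floor]; push_cast; linarith
      · have := Int.floor_le (⟪e i, w⟫ / (c * t))
        have h3 : (⌊⟪e i, w⟫ / (c * t)⌋ : ℝ) ≤ N := by linarith
        exact_mod_cast h3
    simp only [mem_iUnion]
    exact ⟨(⌊⟪e 2, w⟫ / (c * t)⌋, ⌊⟪e 3, w⟫ / (c * t)⌋), Finset.mem_product.2 ⟨aux 2, aux 3⟩,
      hw, hws, rfl, rfl⟩
  have hAeq : ν.real A = ν.real (A ∩ msupp ν) := by
    refine measureReal_congr ?_
    filter_upwards [msupp_ae ν] with w hw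
    exact propext ⟨fun h => ⟨h, hw⟩, fun h => h.1⟩
  have hfin : ν (⋃ k ∈ I ×ˢ I, f k) ≠ ∞ := by
    refine ((measure_mono ?_).trans_lt (h.fin 0 t)).ne
    simp only [iUnion_subset_iff]
    exact fun k _ w hw => hAb hw.1
  rw [hAeq]
  calc ν.real (A ∩ msupp ν) ≤ ν.real (⋃ k ∈ I ×ˢ I, f k) := measureReal_mono hcov hfin
    _ ≤ ∑ k ∈ I ×ˢ I, ν.real (f k) := measureReal_biUnion_finset_le _ _
    _ ≤ ∑ k ∈ I ×ˢ I, 128 * c ^ 3 * t ^ 3 := Finset.sum_le_sum (fun k _ => hcell k)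
    _ = (I.card : ℝ) ^ 2 * (128 * c ^ 3 * t ^ 3) := by
      rw [Finset.sum_const, Finset.card_product, nsmul_eq_mul]; push_cast; ring
    _ ≤ (2.6 / c) ^ 2 * (128 * c ^ 3 * t ^ 3) := by
      gcongr
      have hN0 : 0 ≤ N := by
        have : (0 : ℝ) ≤ N := le_trans (by positivity) hN1
        exact_mod_cast this
      have : (I.card : ℤ) = 2 * N + 1 := by
        rw [hI, Int.card_Icc, Int.toNat_of_nonneg (by omega)]; ring
      have h2 : (I.card : ℝ) = 2 * N + 1 := by exact_mod_cast this
      have h3 : 5 ≤ 1 / c := by rw [le_div_iff₀ hc]; linarith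
      rw [h2, div_eq_mul_one_div]
      linarith
    _ ≤ 900 * c * t ^ 3 := by
      have : 0 < c * t ^ 3 := by positivity
      have e : (2.6 / c) ^ 2 * (128 * c ^ 3 * t ^ 3) = 865.28 * (c * t ^ 3) := by
        field_simp; ring
      rw [e]; linarith

theorem Good.CL {ν : Measure (E 4)} {η R : ℝ} (h : Good ν η R) {u v : E 4} (hu : ‖u‖ = 1)
    (hv : ‖v‖ = 1) (huv : |⟪u, v⟫| ≤ 1 / 2) {c t : ℝ} (hc : 0 < c) (hc1 : c ≤ 1 / 10) (ht : 0 < t)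
    (htR : t ≤ R) :
    ν.real {w | ‖w‖ ≤ t ∧ |⟪u, w⟫| ≤ c * t ∧ |⟪v, w⟫| ≤ c * t} ≤ 1800 * c * t ^ 3 := by
  set v' := v - ⟪u, v⟫ • u with hv'
  have huv2 := huv
  rw [abs_le] at huv2
  have h1 : ‖v'‖ ^ 2 = 1 - ⟪u, v⟫ ^ 2 := by
    rw [hv', norm_sub_sq_real, hv, norm_smul, hu, real_inner_smul_right, real_inner_comm]
    simp; ring
  have h2 : 0.8 ≤ ‖v'‖ := by
    refine (abs_le_of_sq_le_sq' (a := 0.8) ?_ (norm_nonneg _)).2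
    rw [h1]; nlinarith
  have h3 : 0 < ‖v'‖ := by linarith
  have h4 : ⟪u, v'⟫ = 0 := by
    rw [hv', inner_sub_right, real_inner_smul_right, real_inner_self_eq_norm_sq, hu]; ring
  have := h.CL0 (u := u) (v := ‖v'‖⁻¹ • v') hu (by rw [norm_smul]; simp; field_simp)
    (by rw [real_inner_smul_right, h4]; ring) (c := 2 * c) (by positivity) (by linarith) ht htR
  refine le_trans (measureReal_mono ?_ ?_) (this.trans (by linarith))
  · rintro w ⟨hw1, hw2, hw3⟩
    refine ⟨hw1, hw2.trans ?_, ?_⟩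
    · have : 0 < c * t := by positivity
      linarith
    · rw [real_inner_smul_left, abs_mul, abs_of_pos (by positivity), inv_mul_le_iff₀ h3, hv',
        inner_sub_left, real_inner_smul_left]
      have a1 : |⟪u, v⟫ * ⟪u, w⟫| ≤ 1 / 2 * (c * t) := by
        rw [abs_mul]; gcongr
      have : 0 < c * t := by positivity
      rw [← hv']
      refine (abs_sub _ _).trans ?_
      nlinarith
  · refine ((measure_mono ?_).trans_lt (h.fin 0 t)).ne
    intro w hw
    simpa using hw.1

theorem Good.QQ_diff {ν : Measure (E 4)} {η R : ℝ} (h : Good ν η R) {r : ℝ} (hr : 0 < r)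
    (hrR : r ≤ R) (x y : E 4) : |QQ ν r x - QQ ν r y| ≤ 10 * ‖x - y‖ * ‖x + y‖ := by
  unfold QQ
  rw [← mul_sub, ← integral_sub (h.int (by fun_prop) 0 r) (h.int (by fun_prop) 0 r), abs_mul,
    abs_of_pos (by positivity)]
  have h1 : ‖∫ w in closedBall (0 : E 4) r, (⟪x, w⟫ ^ 2 - ⟪y, w⟫ ^ 2) ∂ν‖ ≤
      ‖x - y‖ * ‖x + y‖ * r ^ 2 * ν.real (closedBall 0 r) := by
    refine norm_setIntegral_le_of_norm_le_const (h.fin 0 r) (fun w hw => ?_)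
    have hw' : ‖w‖ ≤ r := by simpa using hw
    have : ⟪x, w⟫ ^ 2 - ⟪y, w⟫ ^ 2 = ⟪x - y, w⟫ * ⟪x + y, w⟫ := by
      rw [inner_sub_left, inner_add_left]; ring
    rw [this, norm_mul]
    calc ‖⟪x - y, w⟫‖ * ‖⟪x + y, w⟫‖ ≤ (‖x - y‖ * ‖w‖) * (‖x + y‖ * ‖w‖) := by
          gcongr <;> exact norm_inner_le_norm _ _
      _ ≤ (‖x - y‖ * r) * (‖x + y‖ * r) := by gcongr
      _ = _ := by ring
  rw [← Real.norm_eq_abs]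
  calc _ ≤ 5 / r ^ 5 * (‖x - y‖ * ‖x + y‖ * r ^ 2 * (2 * r ^ 3)) := by
        gcongr
        exact h1.trans (by gcongr; exact h.up0 hr hrR)
    _ = _ := by field_simp; ring

theorem Good.QQ_le {ν : Measure (E 4)} {η R : ℝ} (h : Good ν η R) {r : ℝ} (hr : 0 < r)
    (hrR : r ≤ R) (x : E 4) : QQ ν r x ≤ 10 * ‖x‖ ^ 2 := by
  have := h.QQ_diff hr hrR x 0
  have h0 : QQ ν r 0 = 0 := by simp [QQ]
  rw [h0] at this
  simp only [sub_zero, add_zero] at this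
  linarith [le_abs_self (QQ ν r x)]

theorem Good.bet_abs {ν : Measure (E 4)} {η R : ℝ} (h : Good ν η R) {r : ℝ} (hr : 0 < r)
    (hrR : r ≤ R) {v : E 4} {c : ℝ} (hs : ∀ x ∈ msupp ν, ‖x‖ ≤ r → |⟪v, x⟫| ≤ c * r) (hc : 0 ≤ c) :
    |⟪bet ν r, v⟫| ≤ 10 * c * r := by
  rw [abs_le]
  have h1 := h.bet_strip hr hrR (fun x hx hxr => (abs_le.1 (hs x hx hxr)).2) hc
  have h2 := h.bet_strip hr hrR (v := -v) (fun x hx hxr => by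
    rw [inner_neg_left]; linarith [(abs_le.1 (hs x hx hxr)).1]) hc
  rw [inner_neg_right] at h2
  constructor <;> linarith

/-- crude consequence of star -/
theorem Good.star_bet {ν : Measure (E 4)} {η R : ℝ} (h : Good ν η R) {r : ℝ} (hr : 0 < r)
    (hrR : 2 * r ≤ R) {x : E 4} (hx : x ∈ msupp ν) (hxr : ‖x‖ ≤ r / 2) :
    |⟪bet ν r, x⟫| ≤ 10 * ‖x‖ ^ 2 + 120 * (‖x‖ ^ 3 / r + η * r ^ 2) := by
  have h1 := abs_le.1 (h.star hr hrR hx hxr)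
  have h2 := h.QQ_le hr (by linarith) x
  have h3 := Good.QQ_nonneg (ν := ν) hr x
  rw [abs_le]
  constructor <;> nlinarith [sq_nonneg ‖x‖]


/-- strip condition -/
def Str (ν : Measure (E 4)) (n : E 4) (t w : ℝ) : Prop :=
  ∀ x ∈ msupp ν, ‖x‖ ≤ t → |⟪n, x⟫| ≤ w

theorem Str.mono {ν : Measure (E 4)} {n : E 4} {t w t' w' : ℝ} (h : Str ν n t w) (ht : t' ≤ t)
    (hw : w ≤ w') : Str ν n t' w' := fun x hx hxt => (h x hx (hxt.trans ht)).trans hw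

theorem Good.HLa {ν : Measure (E 4)} {η R : ℝ} (h : Good ν η R) {σ ε : ℝ} (hσ : 0 < σ)
    (hσR : 2 * σ ≤ R) (hε0 : 0 < ε) (hε : ε ≤ 1 / 10 ^ 10) {e n : E 4} (he : ‖e‖ = 1) (hn : ‖n‖ = 1)
    (hen : |⟪e, n⟫| ≤ ε) (hs : Str ν n σ (ε * σ))
    (hs2 : ∀ x ∈ msupp ν, ‖x‖ ≤ σ → ⟪e, x⟫ ≤ ε * σ) :
    ⟪bet ν σ, e⟫ ≤ - (1 / 144000) * σ := by
  have hCL := h.CL hn he (by rw [real_inner_comm]; linarith) (c := 1 / 7200) (by norm_num)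
    (by norm_num) (t := σ / 2) (by positivity) (by linarith)
  set A := {w : E 4 | ‖w‖ ≤ σ / 2 ∧ |⟪n, w⟫| ≤ 1 / 7200 * (σ / 2) ∧ |⟪e, w⟫| ≤ 1 / 7200 * (σ / 2)} with hA
  have hAm : MeasurableSet A := by
    have : IsClosed A := by
      refine IsClosed.inter (s₁ := {w : E 4 | ‖w‖ ≤ σ / 2}) ?_ (IsClosed.inter
        (s₁ := {w : E 4 | |⟪n, w⟫| ≤ 1 / 7200 * (σ / 2)})
        (s₂ := {w : E 4 | |⟪e, w⟫| ≤ 1 / 7200 * (σ / 2)}) ?_ ?_)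
      all_goals exact isClosed_le (by fun_prop) (by fun_prop)
    exact this.measurableSet
  have hAb : A ⊆ closedBall 0 (σ / 2) := fun w hw => by simpa using hw.1
  set B := closedBall (0 : E 4) (σ / 2) \ A with hB
  have hBm : MeasurableSet B := measurableSet_closedBall.diff hAm
  have hBv : σ ^ 3 / 32 ≤ ν.real B := by
    rw [hB, measureReal_sdiff hAb hAm (h.fin _ _).ne]
    have h1 := h.lo0 (t := σ / 2) (by positivity) (by linarith)
    have h2 : (σ / 2) ^ 3 = σ ^ 3 / 8 := by ring
    rw [h2] at h1 hCL
    linarith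
  have hBsub : B ⊆ closedBall 0 σ := sdiff_subset.trans (closedBall_subset_closedBall (by linarith))
  have iB : IntegrableOn (B.indicator (fun _ => σ ^ 3 / 20000)) (closedBall (0 : E 4) σ) ν :=
    ((integrableOn_const (hs := ((measure_mono hBsub).trans_lt (h.fin 0 σ)).ne)).integrable_indicator
      hBm).integrableOn
  have key : ∫ w in closedBall (0 : E 4) σ, (σ ^ 2 - ‖w‖ ^ 2) * ⟪e, w⟫ ∂ν ≤
      ∫ w in closedBall (0 : E 4) σ, (ε * σ ^ 3 - B.indicator (fun _ => σ ^ 3 / 20000) w) ∂ν := by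
    refine integral_mono_ae (h.int (by fun_prop) 0 σ) ((h.int (by fun_prop) 0 σ).sub iB) ?_
    filter_upwards [ae_restrict_of_ae (msupp_ae ν), ae_restrict_mem measurableSet_closedBall]
      with w hw hwσ
    have hwσ' : ‖w‖ ≤ σ := by simpa using hwσ
    have h1 := hs w hw hwσ'
    have h2 := hs2 w hw hwσ'
    have hσ3 : 0 < σ ^ 3 := by positivity
    by_cases hwB : w ∈ B
    · rw [indicator_of_mem hwB]
      have h3 : ‖w‖ ≤ σ / 2 := by simpa using hwB.1
      have h4 : 1 / 7200 * (σ / 2) < |⟪e, w⟫| := by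
        by_contra hc
        exact hwB.2 ⟨h3, h1.trans (by nlinarith), not_lt.1 hc⟩
      have h5 : ⟪e, w⟫ < - (1 / 7200 * (σ / 2)) := by
        rcases lt_abs.1 h4 with h6 | h6
        · nlinarith
        · linarith
      have h6 : 3 / 4 * σ ^ 2 ≤ σ ^ 2 - ‖w‖ ^ 2 := by nlinarith [norm_nonneg w]
      have h7 : (σ ^ 2 - ‖w‖ ^ 2) * ⟪e, w⟫ ≤ 3 / 4 * σ ^ 2 * (- (1 / 7200 * (σ / 2))) := by
        have : 0 < 3 / 4 * σ ^ 2 := by positivity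
        nlinarith
      have h8 : 3 / 4 * σ ^ 2 * (- (1 / 7200 * (σ / 2))) = - (σ ^ 3 / 19200) := by ring
      change (σ ^ 2 - ‖w‖ ^ 2) * ⟪e, w⟫ ≤ ε * σ ^ 3 - σ ^ 3 / 20000
      nlinarith [mul_pos hε0 hσ3]
    · rw [indicator_of_notMem hwB, sub_zero]
      have h4 : 0 ≤ σ ^ 2 - ‖w‖ ^ 2 := by nlinarith [norm_nonneg w]
      have h5 : (σ ^ 2 - ‖w‖ ^ 2) * ⟪e, w⟫ ≤ (σ ^ 2 - ‖w‖ ^ 2) * (ε * σ) := by gcongr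
      have h6 : (σ ^ 2 - ‖w‖ ^ 2) * (ε * σ) ≤ σ ^ 2 * (ε * σ) := by
        gcongr; linarith [sq_nonneg ‖w‖]
      nlinarith
  rw [integral_sub (h.int (by fun_prop) 0 σ) iB, setIntegral_indicator hBm, inter_eq_right.2 hBsub,
    setIntegral_const, setIntegral_const, smul_eq_mul, smul_eq_mul] at key
  have hV := h.up0 hσ (by linarith)
  rw [h.inner_bet]
  have hσ3 : 0 < σ ^ 3 := by positivity
  calc _ ≤ 5 / σ ^ 5 * ((2 * σ ^ 3) * (ε * σ ^ 3) - (σ ^ 3 / 32) * (σ ^ 3 / 20000)) := by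
        refine mul_le_mul_of_nonneg_left (key.trans ?_) (by positivity)
        gcongr
    _ = (10 * ε - 5 / 640000) * σ := by field_simp; ring
    _ ≤ _ := by nlinarith

/-- half-plane constant -/
def eH : ℝ := 1 / 10 ^ 33

theorem eH_pos : 0 < eH := by unfold eH; positivity

theorem Good.HL {ν : Measure (E 4)} {η R : ℝ} (h : Good ν η R) (hη : η ≤ eH) {σ : ℝ} (hσ : 0 < σ)
    (hσR : 2 * σ ≤ R) {e n : E 4} (he : ‖e‖ = 1) (hn : ‖n‖ = 1)
    (hen : |⟪e, n⟫| ≤ eH) (hs : Str ν n σ (eH * σ))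
    (hs2 : ∀ x ∈ msupp ν, ‖x‖ ≤ σ → ⟪e, x⟫ ≤ eH * σ) : False := by
  have h1 := h.HLa hσ hσR eH_pos (by unfold eH; norm_num) he hn hen hs hs2
  have h2 : 1 / 144000 * σ ≤ ‖bet ν σ‖ := by
    have := abs_real_inner_le_norm (bet ν σ) e
    rw [he, mul_one] at this
    linarith [neg_abs_le ⟪bet ν σ, e⟫]
  have hb : 0 < ‖bet ν σ‖ := lt_of_lt_of_le (by positivity) h2
  have h3 := h.bet_abs hσ (by linarith) (v := n) (c := eH) hs eH_pos.le
  set t : ℝ := σ / 10 ^ 10 with ht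
  have ht0 : 0 < t := by positivity
  have hσt : σ = 10 ^ 10 * t := by rw [ht]; ring
  have h4 : ∀ x ∈ msupp ν, ‖x‖ ≤ t → |⟪bet ν σ, x⟫| ≤ 12 * t ^ 2 := by
    intro x hx hxt
    have a1 := h.star_bet hσ hσR hx (by linarith)
    have a2 : ‖x‖ ^ 2 ≤ t ^ 2 := by gcongr
    have a3 : ‖x‖ ^ 3 ≤ t ^ 3 := by gcongr
    have a4 : ‖x‖ ^ 3 / σ ≤ t ^ 2 / 10 ^ 10 := by
      rw [hσt, div_le_div_iff₀ (by positivity) (by positivity)]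
      nlinarith
    have a5 : η * σ ^ 2 ≤ t ^ 2 / 10 ^ 10 := by
      calc η * σ ^ 2 ≤ eH * σ ^ 2 := by gcongr
        _ ≤ _ := by
          rw [hσt, eH]
          have : 0 < t ^ 2 := by positivity
          rw [show (1 / 10 ^ 33 * (10 ^ 10 * t) ^ 2 : ℝ) = t ^ 2 / 10 ^ 13 by ring]
          gcongr <;> norm_num
    have : 0 < t ^ 2 := by positivity
    linarith
  have h5 := h.CL (u := n) (v := ‖bet ν σ‖⁻¹ • bet ν σ) hn
    (by rw [norm_smul]; simp; field_simp) (by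
      rw [real_inner_smul_right, abs_mul, abs_of_pos (by positivity), inv_mul_le_iff₀ hb,
        real_inner_comm]
      unfold eH at h3
      nlinarith) (c := 1 / 4000) (by norm_num) (by norm_num) ht0 (by linarith)
  have h6 : ν.real (closedBall 0 t) ≤ ν.real {w | ‖w‖ ≤ t ∧ |⟪n, w⟫| ≤ 1 / 4000 * t ∧
      |⟪‖bet ν σ‖⁻¹ • bet ν σ, w⟫| ≤ 1 / 4000 * t} := by
    have hfin : ν {w | ‖w‖ ≤ t ∧ |⟪n, w⟫| ≤ 1 / 4000 * t ∧
      |⟪‖bet ν σ‖⁻¹ • bet ν σ, w⟫| ≤ 1 / 4000 * t} ≠ ∞ := by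
      refine ((measure_mono ?_).trans_lt (h.fin 0 t)).ne
      intro w hw
      simpa using hw.1
    rw [measureReal_def, measureReal_def]
    refine ENNReal.toReal_mono hfin (measure_mono_ae ?_)
    filter_upwards [msupp_ae ν] with w hw hwt
    have hwt' : ‖w‖ ≤ t := by
      have h0 : w ∈ closedBall (0 : E 4) t := hwt
      simpa using h0
    refine ⟨hwt', (hs w hw (by linarith)).trans ?_, ?_⟩
    · rw [hσt, eH]; linarith
    · rw [real_inner_smul_left, abs_mul, abs_of_pos (by positivity), inv_mul_le_iff₀ hb]
      refine (h4 w hw hwt').trans ?_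
      have : 1 / 144000 * (10 ^ 10 * t) * (1 / 4000 * t) ≤ ‖bet ν σ‖ * (1 / 4000 * t) := by
        rw [← hσt]; gcongr
      nlinarith
  have h7 := h.lo0 ht0 (by linarith)
  have : 0 < t ^ 3 := by positivity
  linarith

theorem Good.NP {ν : Measure (E 4)} {η R : ℝ} (h : Good ν η R) (hη : η ≤ eH) {σ : ℝ} (hσ : 0 < σ)
    (hσR : 4 * σ ≤ R) {y p n : E 4} (hn : ‖n‖ = 1) (hy : y ∈ msupp ν) (hyR : ‖y‖ ≤ R / 2)
    (hσL : σ ≤ eH * ‖p - y‖) (hnp : |⟪n, p - y⟫| ≤ eH * ‖p - y‖)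
    (h1 : ∀ w ∈ msupp ν, ‖w - y‖ ≤ σ → |⟪n, w - y⟫| ≤ eH * σ ∧ ‖p - y‖ ≤ ‖w - p‖) : False := by
  have hL : 0 < ‖p - y‖ := by
    by_contra hc
    have := eH_pos
    nlinarith
  refine (h.tr hy hyR).HL hη hσ (by linarith) (e := ‖p - y‖⁻¹ • (p - y)) (n := n)
    (by rw [norm_smul]; simp; field_simp) hn ?_ ?_ ?_
  · rw [real_inner_smul_left, abs_mul, abs_of_pos (by positivity), inv_mul_le_iff₀ hL,
      real_inner_comm]
    linarith
  · intro x hx hxσ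
    rw [mem_msupp_tr] at hx
    have := (h1 _ hx (by simpa using hxσ)).1
    simpa using this
  · intro x hx hxσ
    rw [mem_msupp_tr] at hx
    have := (h1 _ hx (by simpa using hxσ)).2
    rw [real_inner_smul_left, inv_mul_le_iff₀ hL]
    have e1 : ‖y + x - p‖ ^ 2 = ‖x‖ ^ 2 - 2 * ⟪p - y, x⟫ + ‖p - y‖ ^ 2 := by
      rw [show y + x - p = x - (p - y) by abel, norm_sub_sq_real, real_inner_comm]
    have e2 : ‖p - y‖ ^ 2 ≤ ‖y + x - p‖ ^ 2 := by gcongr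
    have e3 : ‖x‖ ^ 2 ≤ σ ^ 2 := by gcongr
    have e4 : σ * σ ≤ (eH * ‖p - y‖) * σ := by gcongr
    nlinarith

theorem Good.hole {ν : Measure (E 4)} {η R : ℝ} (h : Good ν η R) (hη : η ≤ eH) {κ t : ℝ}
    (hκ : 0 < κ) (hκ1 : κ ≤ 1) (ht : 0 < t) (htR : 4 * t ≤ R) {n : E 4} (hn : ‖n‖ = 1)
    (hs : Str ν n (3 * t) (eH ^ 2 * κ / 2 * t)) {p : E 4} (hp : ⟪n, p⟫ = 0) (hpt : ‖p‖ ≤ t) :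
    ∃ x ∈ msupp ν, ‖x - p‖ ≤ κ * t := by
  by_contra hc
  push Not at hc
  have he := eH_pos
  have he1 : eH ≤ 1 / 10 := by unfold eH; norm_num
  obtain ⟨y, hy, hyd⟩ := (msupp_closed ν).exists_infDist_eq_dist ⟨0, h.zero⟩ p
  have hmin : ∀ w ∈ msupp ν, ‖p - y‖ ≤ ‖w - p‖ := by
    intro w hw
    have := infDist_le_dist_of_mem (x := p) hw
    rw [hyd, dist_eq_norm, dist_eq_norm] at this
    rwa [norm_sub_rev w p]
  have hLt : ‖p - y‖ ≤ t := by
    have := hmin 0 h.zero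
    simp at this; linarith
  have hLk : κ * t < ‖p - y‖ := by rw [norm_sub_rev]; exact hc y hy
  have hyt : ‖y‖ ≤ 2 * t := by
    have := norm_sub_le p (p - y)
    rw [sub_sub_cancel] at this
    linarith
  have hκt : 0 < κ * t := by positivity
  have hκt1 : κ * t ≤ t := by nlinarith
  refine h.NP hη (σ := eH * (κ * t)) (by positivity) (by nlinarith) hn hy (by linarith) (p := p)
    (by nlinarith) ?_ ?_
  · rw [inner_sub_right, hp, zero_sub, abs_neg]
    refine (hs y hy (by linarith)).trans ?_
    calc eH ^ 2 * κ / 2 * t = eH * (eH / 2 * (κ * t)) := by ring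
      _ ≤ eH * (1 * ‖p - y‖) := by gcongr; linarith
      _ = _ := by ring
  · intro w hw hwy
    refine ⟨?_, hmin w hw⟩
    have hwt : ‖w‖ ≤ 3 * t := by
      have := norm_add_le (w - y) y
      rw [sub_add_cancel] at this
      nlinarith
    rw [inner_sub_right]
    have a1 := hs y hy (by linarith)
    have a2 := hs w hw hwt
    refine (abs_sub _ _).trans ?_
    calc |⟪n, w⟫| + |⟪n, y⟫| ≤ eH ^ 2 * κ / 2 * t + eH ^ 2 * κ / 2 * t := by gcongr
      _ = _ := by ring


theorem Good.QQ_smul {ν : Measure (E 4)} (r c : ℝ) (x : E 4) :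
    QQ ν r (c • x) = c ^ 2 * QQ ν r x := by
  simp only [QQ, real_inner_smul_left, mul_pow, integral_const_mul]; ring

/-- two nearly opposite points pin down the second moment -/
theorem Good.Q_one {ν : Measure (E 4)} {η R : ℝ} (h : Good ν η R) {r t κ : ℝ} (hr : 0 < r)
    (hrR : 2 * r ≤ R) (ht : 0 < t) (htr : 4 * t ≤ r) (hκ0 : 0 ≤ κ) (hκ : κ ≤ 1) {e x y : E 4}
    (he : ‖e‖ = 1)
    (hx : x ∈ msupp ν) (hy : y ∈ msupp ν) (hxe : ‖x - t • e‖ ≤ κ * t) (hye : ‖y - (-(t • e))‖ ≤ κ * t) :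
    |QQ ν r e - 1| * t ^ 2 ≤ 10 * r * κ * t + 33 * κ * t ^ 2 + 960 * t ^ 3 / r + 120 * η * r ^ 2 := by
  have hte : ‖t • e‖ = t := by rw [norm_smul, he, mul_one, Real.norm_of_nonneg ht.le]
  have aux : ∀ z v : E 4, ‖v‖ = t → z ∈ msupp ν → ‖z - v‖ ≤ κ * t →
      |⟪bet ν r, z⟫ + QQ ν r v - t ^ 2| ≤ 33 * κ * t ^ 2 + 960 * t ^ 3 / r + 120 * η * r ^ 2 := by
    intro z v hv hz hzv
    have hz1 : ‖z‖ ≤ 2 * t := by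
      have := norm_add_le (z - v) v
      rw [sub_add_cancel] at this
      nlinarith
    have a1 := h.star hr hrR hz (by linarith)
    have a2 := h.QQ_diff hr (by linarith) z v
    have a3 : ‖z + v‖ ≤ 3 * t := (norm_add_le _ _).trans (by linarith)
    have a4 : ‖z - v‖ * ‖z + v‖ ≤ (κ * t) * (3 * t) := by gcongr
    have a5 : |‖z‖ ^ 2 - t ^ 2| ≤ (κ * t) * (3 * t) := by
      rw [← hv, sq_sub_sq, abs_mul]
      rw [mul_comm]
      refine mul_le_mul ((abs_norm_sub_norm_le z v).trans (hv ▸ hzv)) ?_ (abs_nonneg _) (by rw [hv]; positivity)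
      rw [abs_of_nonneg (by positivity)]; linarith
    have a6 : ‖z‖ ^ 3 ≤ (2 * t) ^ 3 := by gcongr
    have a7 : ‖z‖ ^ 3 / r ≤ 8 * t ^ 3 / r := by gcongr; linarith [mul_pow 2 t 3]
    have a8 : 960 * t ^ 3 / r = 120 * (8 * t ^ 3 / r) := by ring
    rw [a8]
    rw [abs_le] at *
    constructor <;> nlinarith
  have h1 := aux x (t • e) hte hx hxe
  have h2 := aux y (-(t • e)) (by rw [norm_neg, hte]) hy hye
  have h3 : QQ ν r (-(t • e)) = t ^ 2 * QQ ν r e := by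
    rw [← neg_smul, Good.QQ_smul]; ring
  rw [h3] at h2
  rw [Good.QQ_smul] at h1
  have h4 : |⟪bet ν r, x⟫ + ⟪bet ν r, y⟫| ≤ 10 * r * (2 * (κ * t)) := by
    rw [← inner_add_right]
    refine (abs_real_inner_le_norm _ _).trans ?_
    gcongr
    · exact h.bet_norm hr (by linarith)
    · have := norm_add_le (x - t • e) (y - (-(t • e)))
      rw [show x - t • e + (y - (-(t • e))) = x + y by abel] at this
      linarith
  have h5 : |QQ ν r e - 1| * t ^ 2 = |t ^ 2 * QQ ν r e - t ^ 2| := by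
    rw [show t ^ 2 * QQ ν r e - t ^ 2 = (QQ ν r e - 1) * t ^ 2 by ring, abs_mul,
      abs_of_pos (by positivity : 0 < t ^ 2)]
  rw [h5]
  rw [abs_le] at *
  constructor <;> nlinarith

/-- constant for the D lemma -/
def wD : ℝ := 1 / 10 ^ 110

theorem wD_pos : 0 < wD := by unfold wD; positivity

theorem Good.Dlem {ν : Measure (E 4)} {η R : ℝ} (h : Good ν η R) (hη : η ≤ wD) {d : ℝ}
    (hd : 0 < d) (hdR : 40 * d ≤ R) {n : E 4} (hn : ‖n‖ = 1) (hs : Str ν n (d / 2) (wD * d))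
    {z : E 4} (hz : z ∈ msupp ν) (hzd : ‖z‖ ≤ 10 * d) : |⟪n, z⟫| < d / 2 := by
  by_contra hc
  push Not at hc
  obtain ⟨e, he⟩ := onb1 hn
  have hη0 := h.eta0
  have hηH : η ≤ eH := hη.trans (by unfold wD eH; norm_num)
  set t := d / 10 ^ 12 with ht
  have ht0 : 0 < t := by positivity
  have hdt : d = 10 ^ 12 * t := by rw [ht]; ring
  have hstr : Str ν n (3 * t) (eH ^ 2 * (1 / 10 ^ 25) / 2 * t) := by
    refine hs.mono (by linarith) ?_
    rw [hdt, eH, wD]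
    rw [show (1 / 10 ^ 110 * (10 ^ 12 * t) : ℝ) = (1 / 10 ^ 98) * t by ring]
    exact mul_le_mul_of_nonneg_right (by norm_num) (by positivity)
  have hQ : ∀ i : Fin 4, i ≠ 3 → |QQ ν (20 * d) (e i) - 1| ≤ 1 / 10 ^ 10 := by
    intro i hi
    have hin : ⟪n, e i⟫ = 0 := by rw [← he]; exact e.orthonormal.2 (Ne.symm hi)
    have hei : ‖e i‖ = 1 := e.orthonormal.1 i
    have hte : ‖t • e i‖ = t := by rw [norm_smul, hei, mul_one, Real.norm_of_nonneg ht0.le]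
    obtain ⟨x, hx, hxe⟩ := h.hole hηH (κ := 1 / 10 ^ 25) (by norm_num) (by norm_num) ht0
      (by linarith) hn hstr (p := t • e i) (by rw [real_inner_smul_right, hin, mul_zero]) hte.le
    obtain ⟨y, hy, hye⟩ := h.hole hηH (κ := 1 / 10 ^ 25) (by norm_num) (by norm_num) ht0
      (by linarith) hn hstr (p := -(t • e i)) (by rw [inner_neg_right, real_inner_smul_right, hin, mul_zero, neg_zero])
      (by rw [norm_neg]; exact hte.le)
    have := h.Q_one (r := 20 * d) (by positivity) (by linarith) ht0 (by linarith) (by norm_num) (by norm_num)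
      hei hx hy hxe hye
    have h1 : 960 * t ^ 3 / (20 * d) = 48 / 10 ^ 12 * t ^ 2 := by rw [hdt]; field_simp; ring
    have h2 : 120 * η * (20 * d) ^ 2 ≤ 1 / 10 ^ 20 * t ^ 2 := by
      rw [hdt]
      have : 120 * η * (20 * (10 ^ 12 * t)) ^ 2 = 48000 * 10 ^ 24 * t ^ 2 * η := by ring
      rw [this]
      have : 48000 * 10 ^ 24 * t ^ 2 * η ≤ 48000 * 10 ^ 24 * t ^ 2 * wD := by gcongr
      refine this.trans ?_
      rw [wD]
      rw [show (48000 * 10 ^ 24 * t ^ 2 * (1 / 10 ^ 110) : ℝ) = (48000 * 10 ^ 24 / 10 ^ 110) * t ^ 2 by ring]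
      exact mul_le_mul_of_nonneg_right (by norm_num) (by positivity)
    rw [h1] at this
    have h3 : 10 * (20 * d) * (1 / 10 ^ 25) * t = 200 / 10 ^ 13 * t ^ 2 := by rw [hdt]; ring
    rw [h3] at this
    have ht2 : 0 < t ^ 2 := by positivity
    refine le_of_mul_le_mul_right ?_ ht2
    linarith
  have htr := h.trace (r := 20 * d) (by positivity) (by linarith) e
  rw [Fin.sum_univ_four] at htr
  have q0 := hQ 0 (by decide)
  have q1 := hQ 1 (by decide)
  have q2 := hQ 2 (by decide)
  rw [he] at htr
  rw [abs_le] at htr q0 q1 q2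
  have hup : QQ ν (20 * d) n ≤ 4 / 10 ^ 10 := by
    have : η ≤ 1 / 10 ^ 12 := hη.trans (by unfold wD; norm_num)
    linarith
  have hlow : 7 / 10 ^ 10 ≤ QQ ν (20 * d) n := by
    have hsub : closedBall z (d / 4) ⊆ closedBall 0 (20 * d) := by
      refine closedBall_subset_closedBall' ?_
      rw [dist_zero_right]; linarith
    have h1 := h.lo hz (by linarith) (t := d / 4) (by positivity) (by linarith)
    have h2 : ∫ w in closedBall z (d / 4), (d / 4) ^ 2 ∂ν ≤ ∫ w in closedBall z (d / 4), ⟪n, w⟫ ^ 2 ∂ν := by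
      refine setIntegral_mono_on (h.int (by fun_prop) _ _) (h.int (by fun_prop) _ _)
        measurableSet_closedBall (fun w hw => ?_)
      rw [mem_closedBall, dist_eq_norm] at hw
      have a1 : |⟪n, w - z⟫| ≤ d / 4 := (abs_real_inner_le_norm _ _).trans (by rw [hn]; linarith)
      rw [inner_sub_right] at a1
      rw [← sq_abs ⟪n, w⟫]
      gcongr
      have := abs_sub_abs_le_abs_sub ⟪n, z⟫ ⟪n, w⟫
      rw [abs_sub_comm] at this
      linarith
    rw [setIntegral_const, smul_eq_mul] at h2
    have h3 : ∫ w in closedBall z (d / 4), ⟪n, w⟫ ^ 2 ∂ν ≤ ∫ w in closedBall 0 (20 * d), ⟪n, w⟫ ^ 2 ∂ν :=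
      setIntegral_mono_set (h.int (by fun_prop) _ _) (Eventually.of_forall fun w => sq_nonneg _)
        (Eventually.of_forall hsub)
    unfold QQ
    calc (7 / 10 ^ 10 : ℝ) ≤ 5 / (20 * d) ^ 5 * ((d / 4) ^ 3 / 2 * (d / 4) ^ 2) := by
          rw [show 5 / (20 * d) ^ 5 * ((d / 4) ^ 3 / 2 * (d / 4) ^ 2) = 5 / (20 ^ 5 * 4 ^ 5 * 2 : ℝ) by
            field_simp]
          norm_num
      _ ≤ _ := by
        gcongr
        refine le_trans ?_ (h2.trans h3)
        gcongr
  linarith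


theorem Good.spec {ν : Measure (E 4)} {η R : ℝ} (h : Good ν η R) (r : ℝ) :
    ∃ (e : OrthonormalBasis (Fin 4) ℝ (E 4)) (l : Fin 4 → ℝ),
      (∀ x, QQ ν r x = ∑ i, l i * ⟪e i, x⟫ ^ 2) ∧ Antitone l ∧ 0 ≤ ⟪bet ν r, e 3⟫ := by
  let T : E 4 →ₗ[ℝ] E 4 :=
    { toFun := fun x => (5 / r ^ 5) • ∫ w in closedBall (0 : E 4) r, ⟪x, w⟫ • w ∂ν
      map_add' := fun x y => by
        rw [← smul_add, ← integral_add (h.int (by fun_prop) 0 r) (h.int (by fun_prop) 0 r)]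
        simp only [inner_add_left, add_smul]
      map_smul' := fun c x => by
        simp only [real_inner_smul_left, mul_smul, RingHom.id_apply]
        rw [integral_smul, smul_comm] }
  have hTi : ∀ x y, ⟪T x, y⟫ = 5 / r ^ 5 * ∫ w in closedBall (0 : E 4) r, ⟪x, w⟫ * ⟪y, w⟫ ∂ν := by
    intro x y
    change ⟪(5 / r ^ 5) • ∫ w in closedBall (0 : E 4) r, ⟪x, w⟫ • w ∂ν, y⟫ = _
    rw [real_inner_smul_left, real_inner_comm, ← integral_inner (h.int (by fun_prop) 0 r)]
    simp only [real_inner_smul_right]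
  have hT : T.IsSymmetric := by
    intro x y
    rw [hTi, real_inner_comm, hTi]
    simp only [mul_comm]
  have hfr : finrank ℝ (E 4) = 4 := by simp
  have key : ∀ x, QQ ν r x = ∑ i, hT.eigenvalues hfr i * ⟪hT.eigenvectorBasis hfr i, x⟫ ^ 2 := by
    intro x
    have h1 : QQ ν r x = ⟪T x, x⟫ := by rw [hTi, QQ]; simp only [pow_two]
    rw [h1, ← (hT.eigenvectorBasis hfr).sum_inner_mul_inner (T x) x]
    refine Finset.sum_congr rfl (fun i _ => ?_)
    rw [hT x, hT.apply_eigenvectorBasis hfr i, real_inner_comm]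
    simp only [RCLike.ofReal_real_eq_id, id_eq, real_inner_smul_left]
    rw [pow_two]; ring
  rcases le_total 0 ⟪bet ν r, hT.eigenvectorBasis hfr 3⟫ with h0 | h0
  · exact ⟨hT.eigenvectorBasis hfr, hT.eigenvalues hfr, key, hT.eigenvalues_antitone hfr, h0⟩
  · refine ⟨(hT.eigenvectorBasis hfr).map (LinearIsometryEquiv.neg ℝ), hT.eigenvalues hfr, ?_,
      hT.eigenvalues_antitone hfr, ?_⟩
    · intro x
      rw [key]
      simp
    · simpa using h0

theorem alg1 {a c k x p L b : ℝ} (ha : |a| ≤ 2 * L) (hp : p = c ∧ b ≤ 0 ∨ p = -c ∧ 0 ≤ b) (hc : 0 ≤ c)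
    (hx : |x - p| ≤ k) :
    a * c ^ 2 - 2 * L * k * (2 * c + k) + |b| * (c - k) ≤ a * x ^ 2 - b * x := by
  have hk : 0 ≤ k := (abs_nonneg _).trans hx
  have hL : 0 ≤ 2 * L := (abs_nonneg _).trans ha
  have h2 : p ^ 2 = c ^ 2 := by rcases hp with ⟨h, _⟩ | ⟨h, _⟩ <;> rw [h]; ring
  have hpc : |p| = c := by
    rcases hp with ⟨h, _⟩ | ⟨h, _⟩ <;> rw [h]
    · exact abs_of_nonneg hc
    · rw [abs_neg]; exact abs_of_nonneg hc
  have h3 : |x + p| ≤ 2 * c + k := by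
    have : x + p = (x - p) + (2 * p) := by ring
    rw [this]
    refine (abs_add_le _ _).trans ?_
    rw [abs_mul, hpc, abs_two]; linarith
  have h4 : |a * (x ^ 2 - c ^ 2)| ≤ 2 * L * (k * (2 * c + k)) := by
    rw [← h2, abs_mul, sq_sub_sq, abs_mul, mul_comm |x + p|]
    gcongr
  have h5 : |b * (x - p)| ≤ |b| * k := by rw [abs_mul]; gcongr
  have h6 : -(b * p) = |b| * c := by
    rcases hp with ⟨h, h'⟩ | ⟨h, h'⟩ <;> rw [h]
    · rw [abs_of_nonpos h']; ring
    · rw [abs_of_nonneg h']; ring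
  have h7 := (abs_le.1 h4).1
  have h8 := (abs_le.1 h5).2
  nlinarith

theorem alg2 {a0 a1 a2 : ℝ} (h1 : a0 ≤ a1) (h2 : a1 ≤ a2) (h3 : 0 ≤ a0 + a1 + a2) :
    0 ≤ a2 ∧ |a0| ≤ 2 * a2 ∧ |a1| ≤ 2 * a2 ∧ |a2| ≤ 2 * a2 := by
  refine ⟨by linarith, ?_, ?_, ?_⟩ <;> rw [abs_le] <;> constructor <;> linarith

theorem alg3 {a0 a1 a2 b0 b1 b2 T X0 X1 X2 Y Z W V b : ℝ}
    (g0 : a0 * (T / 8) ^ 2 - 2 * a2 * (1 / 100 * T) * (2 * (T / 8) + 1 / 100 * T) +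
      |b0| * (T / 8 - 1 / 100 * T) ≤ a0 * X0 ^ 2 - b0 * X0)
    (g1 : a1 * (T / 8) ^ 2 - 2 * a2 * (1 / 100 * T) * (2 * (T / 8) + 1 / 100 * T) +
      |b1| * (T / 8 - 1 / 100 * T) ≤ a1 * X1 ^ 2 - b1 * X1)
    (g2 : a2 * (T / 2) ^ 2 - 2 * a2 * (1 / 100 * T) * (2 * (T / 2) + 1 / 100 * T) +
      |b2| * (T / 2 - 1 / 100 * T) ≤ a2 * X2 ^ 2 - b2 * X2)
    (eq : Y + ((a0 * X0 ^ 2 - b0 * X0) + (a1 * X1 ^ 2 - b1 * X1) + (a2 * X2 ^ 2 - b2 * X2)) ≤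
      122 * (Z + W)) (sqr : -(b ^ 2 / 2) ≤ Y) (cub : Z ≤ 8 * V)
    (t1 : 0 ≤ (a0 + a1 + a2) * T ^ 2) (t2 : 0 ≤ a2 * T ^ 2) (t3 : 0 ≤ |b0| * T)
    (t4 : 0 ≤ |b1| * T) (t5 : 0 ≤ |b2| * T) :
    0.2 * (a2 * T ^ 2) + 0.1 * ((|b0| + |b1| + |b2|) * T) ≤ b ^ 2 / 2 + 976 * V + 122 * W := by
  generalize a0 * X0 ^ 2 - b0 * X0 = q0 at *
  generalize a1 * X1 ^ 2 - b1 * X1 = q1 at *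
  generalize a2 * X2 ^ 2 - b2 * X2 = q2 at *
  generalize |b0| = c0 at *
  generalize |b1| = c1 at *
  generalize |b2| = c2 at *
  linarith

theorem alg4 {Y G u v w m K1 c1 c2 : ℝ} (k2 : |G| ≤ u) (k3 : |Y + G| ≤ 122 * (m + w))
    (k4 : u ≤ v) (k5 : v ≤ 10 ^ 4 * (c1 + c2 + K1)) (k7 : K1 ≤ 1 * w) (k8 : m ≤ c2)
    (t1 : 0 ≤ c1) (t2 : 0 ≤ c2) (t3 : 0 ≤ w) : |Y| ≤ 10 ^ 5 * (c1 + c2 + w) := by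
  obtain ⟨a1, a2⟩ := abs_le.1 k2
  obtain ⟨a3, a4⟩ := abs_le.1 k3
  rw [abs_le]
  constructor <;> linarith

/-- strip constant -/
def cS : ℝ := eH ^ 2 / 200

theorem cS_pos : 0 < cS := by unfold cS; have := eH_pos; positivity

/-- constant in the quadratic estimate -/
def C3 : ℝ := 10 ^ 5

/-- the abstract quadratic estimate -/
def Par (ν : Measure (E 4)) (n : E 4) (a b r η : ℝ) : Prop :=
  ∀ t T : ℝ, 0 < t → t ≤ T → 6 * T ≤ r → Str ν n (3 * T) (cS * T) → ∀ x ∈ msupp ν, ‖x‖ ≤ t →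
    |a * ⟪n, x⟫ ^ 2 - b * ⟪n, x⟫| ≤ C3 * (t * b ^ 2 / T + t * T ^ 2 / r + η * r ^ 2)

set_option maxHeartbeats 1000000 in
theorem Good.par {ν : Measure (E 4)} {η R : ℝ} (h : Good ν η R) (hη : η ≤ eH) {r : ℝ} (hr : 0 < r)
    (hrR : 2 * r ≤ R) (e : OrthonormalBasis (Fin 4) ℝ (E 4)) (l : Fin 4 → ℝ)
    (hQ : ∀ x, QQ ν r x = ∑ i, l i * ⟪e i, x⟫ ^ 2) (hl : Antitone l) (hl3 : l 3 ≤ 1 / 2) :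
    Par ν (e 3) (1 - l 3) ⟪bet ν r, e 3⟫ r η := by
  have hη0 := h.eta0
  have hQe : ∀ i, QQ ν r (e i) = l i := by
    intro i
    rw [hQ]
    rw [Finset.sum_eq_single i]
    · simp
    · intro j _ hj
      rw [e.orthonormal.2 hj]; simp
    · simp
  have htr := h.trace hr (by linarith) e
  simp only [hQe, Fin.sum_univ_four] at htr
  have hl0 : 0 ≤ l 3 := by rw [← hQe]; exact Good.QQ_nonneg hr _
  set a := 1 - l 3 with ha
  set n := e 3 with hn
  set b := ⟪bet ν r, n⟫ with hb
  set a0 := 1 - l 0 + 7 * η with ha0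
  set a1 := 1 - l 1 + 7 * η with ha1
  set a2 := 1 - l 2 + 7 * η with ha2
  set β0 := ⟪bet ν r, e 0⟫ with hβ0
  set β1 := ⟪bet ν r, e 1⟫ with hβ1
  set β2 := ⟪bet ν r, e 2⟫ with hβ2
  obtain ⟨A2, A0', A1', A2'⟩ := alg2 (a0 := a0) (a1 := a1) (a2 := a2)
    (by linarith [hl (show (0 : Fin 4) ≤ 1 by decide)])
    (by linarith [hl (show (1 : Fin 4) ≤ 2 by decide)])
    (by linarith [(abs_le.1 htr).2])
  set B := |β0| + |β1| + |β2| with hB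
  have hB0 : 0 ≤ B := by positivity
  -- the basic equation
  have eqn : ∀ x ∈ msupp ν, ‖x‖ ≤ r / 2 →
      |a * ⟪n, x⟫ ^ 2 - b * ⟪n, x⟫ + ((a0 * ⟪e 0, x⟫ ^ 2 - β0 * ⟪e 0, x⟫) +
        (a1 * ⟪e 1, x⟫ ^ 2 - β1 * ⟪e 1, x⟫) + (a2 * ⟪e 2, x⟫ ^ 2 - β2 * ⟪e 2, x⟫))| ≤
        122 * (‖x‖ ^ 3 / r + η * r ^ 2) := by
    intro x hx hxr
    have h1 := h.star hr hrR hx hxr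
    have h2 := norm_sq_onb e x
    have h3 := e.sum_inner_mul_inner (bet ν r) x
    rw [Fin.sum_univ_four] at h3
    have h4 := hQ x
    rw [Fin.sum_univ_four] at h4
    have h5 : η * (⟪e 0, x⟫ ^ 2 + ⟪e 1, x⟫ ^ 2 + ⟪e 2, x⟫ ^ 2) ≤ η * (r / 2) ^ 2 := by
      have h6 : ‖x‖ ^ 2 ≤ (r / 2) ^ 2 := by gcongr
      gcongr
      linarith [sq_nonneg ⟪e 3, x⟫]
    have h5' : 0 ≤ η * (⟪e 0, x⟫ ^ 2 + ⟪e 1, x⟫ ^ 2 + ⟪e 2, x⟫ ^ 2) := by positivity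
    have h6 : 0 ≤ ‖x‖ ^ 3 / r := by positivity
    have h7 : 0 ≤ η * r ^ 2 := by positivity
    rw [← h3, h4, h2, abs_le] at h1
    rw [abs_le, ha, ha0, ha1, ha2]
    rw [← hβ0, ← hβ1, ← hβ2, ← hn, ← hb] at h1
    constructor
    · linarith [h1.2]
    · linarith [h1.1]
  -- upper bound for the tangential part
  have gup : ∀ x : E 4, ∀ t, ‖x‖ ≤ t → |(a0 * ⟪e 0, x⟫ ^ 2 - β0 * ⟪e 0, x⟫) +
        (a1 * ⟪e 1, x⟫ ^ 2 - β1 * ⟪e 1, x⟫) + (a2 * ⟪e 2, x⟫ ^ 2 - β2 * ⟪e 2, x⟫)| ≤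
        2 * a2 * t ^ 2 + B * t := by
    intro x t hxt
    have ht0 : 0 ≤ t := (norm_nonneg x).trans hxt
    have h2 := norm_sq_onb e x
    have h3 : ‖x‖ ^ 2 ≤ t ^ 2 := by gcongr
    have hi : ∀ i, |⟪e i, x⟫| ≤ t := fun i => (abs_real_inner_le_norm _ _).trans (by
      rw [e.orthonormal.1 i]; linarith)
    have q : ∀ a' y : ℝ, |a'| ≤ 2 * a2 → |a' * y ^ 2| ≤ 2 * a2 * y ^ 2 := by
      intro a' y h'
      rw [abs_mul, abs_of_nonneg (sq_nonneg y)]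
      gcongr
    have q' : ∀ b' : ℝ, ∀ i, |b' * ⟪e i, x⟫| ≤ |b'| * t := by
      intro b' i
      rw [abs_mul]; gcongr; exact hi i
    have u0 := q a0 ⟪e 0, x⟫ A0'
    have u1 := q a1 ⟪e 1, x⟫ A1'
    have u2 := q a2 ⟪e 2, x⟫ A2'
    have v0 := q' β0 0
    have v1 := q' β1 1
    have v2 := q' β2 2
    have w : 2 * a2 * (⟪e 0, x⟫ ^ 2 + ⟪e 1, x⟫ ^ 2 + ⟪e 2, x⟫ ^ 2) ≤ 2 * a2 * t ^ 2 := by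
      gcongr
      linarith [sq_nonneg ⟪e 3, x⟫]
    rw [abs_le] at u0 u1 u2 v0 v1 v2 ⊢
    rw [hB]
    constructor <;> linarith [u0.1, u0.2, u1.1, u1.2, u2.1, u2.2, v0.1, v0.2, v1.1, v1.2, v2.1, v2.2]
  -- P1
  have P1 : ∀ T, 0 < T → 6 * T ≤ r → Str ν n (3 * T) (cS * T) →
      2 * a2 * T ^ 2 + B * T ≤ 10 ^ 4 * (b ^ 2 + T ^ 3 / r + η * r ^ 2) := by
    intro T hT hTr hs
    have sg : ∀ (β c : ℝ), ∃ p : ℝ, (p = c ∧ β ≤ 0 ∨ p = -c ∧ 0 ≤ β) := by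
      intro β c
      rcases le_total β 0 with h | h
      · exact ⟨c, Or.inl ⟨rfl, h⟩⟩
      · exact ⟨-c, Or.inr ⟨rfl, h⟩⟩
    obtain ⟨p0, hp0⟩ := sg β0 (T / 8)
    obtain ⟨p1, hp1⟩ := sg β1 (T / 8)
    obtain ⟨p2, hp2⟩ := sg β2 (T / 2)
    have sq : ∀ {p c β : ℝ}, (p = c ∧ β ≤ 0 ∨ p = -c ∧ 0 ≤ β) → p ^ 2 = c ^ 2 := by
      rintro p c β (⟨h, _⟩ | ⟨h, _⟩) <;> rw [h]; ring
    set p : E 4 := p0 • e 0 + p1 • e 1 + p2 • e 2 with hp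
    have ee : ∀ i j, ⟪e i, e j⟫ = if i = j then 1 else 0 := fun i j => by
      rw [e.inner_eq_ite]
    have i0 : ⟪e 0, p⟫ = p0 := by simp [hp, inner_add_right, real_inner_smul_right, ee]
    have i1 : ⟪e 1, p⟫ = p1 := by simp [hp, inner_add_right, real_inner_smul_right, ee]
    have i2 : ⟪e 2, p⟫ = p2 := by simp [hp, inner_add_right, real_inner_smul_right, ee]
    have i3 : ⟪e 3, p⟫ = 0 := by simp [hp, inner_add_right, real_inner_smul_right, ee]
    have hpT : ‖p‖ ≤ T := by
      refine (abs_le_of_sq_le_sq' ?_ hT.le).2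
      rw [norm_sq_onb e, i0, i1, i2, i3, sq hp0, sq hp1, sq hp2]
      nlinarith [sq_nonneg T]
    obtain ⟨x, hx, hxp⟩ := h.hole hη (κ := 1 / 100) (by norm_num) (by norm_num) hT (by linarith)
      (e.orthonormal.1 3) (hs.mono le_rfl (by
        rw [cS]; apply le_of_eq; ring)) i3 hpT
    have hxT : ‖x‖ ≤ 2 * T := by
      have := norm_add_le (x - p) p
      rw [sub_add_cancel] at this
      linarith
    have d : ∀ i, |⟪e i, x⟫ - ⟪e i, p⟫| ≤ 1 / 100 * T := fun i => by
      rw [← inner_sub_right]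
      exact (abs_real_inner_le_norm _ _).trans (by rw [e.orthonormal.1 i]; linarith)
    have g0 := alg1 A0' hp0 (by positivity) (i0 ▸ d 0)
    have g1 := alg1 A1' hp1 (by positivity) (i1 ▸ d 1)
    have g2 := alg1 A2' hp2 (by positivity) (i2 ▸ d 2)
    have eq := (abs_le.1 (eqn x hx (by linarith))).2
    have sqr : -(b ^ 2 / 2) ≤ a * ⟪n, x⟫ ^ 2 - b * ⟪n, x⟫ := by
      have : 1 / 2 * ⟪n, x⟫ ^ 2 ≤ a * ⟪n, x⟫ ^ 2 := by gcongr; linarith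
      nlinarith [sq_nonneg (⟪n, x⟫ - b)]
    have cub : ‖x‖ ^ 3 / r ≤ 8 * (T ^ 3 / r) := by
      rw [← mul_div_assoc]
      gcongr
      calc ‖x‖ ^ 3 ≤ (2 * T) ^ 3 := by gcongr
        _ = _ := by ring
    have t1 : 0 ≤ (a0 + a1 + a2) * T ^ 2 := by
      have : 0 ≤ a0 + a1 + a2 := by linarith [(abs_le.1 htr).2]
      positivity
    have t2 : 0 ≤ a2 * T ^ 2 := by positivity
    have t3 : 0 ≤ |β0| * T := by positivity
    have t4 : 0 ≤ |β1| * T := by positivity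
    have t5 : 0 ≤ |β2| * T := by positivity
    have t6 : 0 ≤ T ^ 3 / r := by positivity
    have t7 : 0 ≤ η * r ^ 2 := by positivity
    have fin : 0.2 * (a2 * T ^ 2) + 0.1 * (B * T) ≤ b ^ 2 / 2 + 976 * (T ^ 3 / r) + 122 * (η * r ^ 2) := by
      rw [hB]
      exact alg3 g0 g1 g2 eq sqr cub t1 t2 t3 t4 t5
    have : 0 ≤ B * T := by positivity
    linarith [sq_nonneg b]
  intro t T ht htT hTr hs x hx hxt
  have hT : 0 < T := by linarith
  have k1 := P1 T hT hTr hs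
  have k2 := gup x t hxt
  have k3 := eqn x hx (by linarith)
  have k4 : 2 * a2 * t ^ 2 + B * t ≤ t / T * (2 * a2 * T ^ 2 + B * T) := by
    have : t / T * (2 * a2 * T ^ 2 + B * T) = 2 * a2 * (t * T) + B * t := by field_simp
    rw [this]
    have : t ^ 2 ≤ t * T := by nlinarith
    gcongr
  have k5 : t / T * (2 * a2 * T ^ 2 + B * T) ≤ t / T * (10 ^ 4 * (b ^ 2 + T ^ 3 / r + η * r ^ 2)) := by
    gcongr
  have k6 : t / T * (10 ^ 4 * (b ^ 2 + T ^ 3 / r + η * r ^ 2)) = 10 ^ 4 * (t * b ^ 2 / T +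
      t * T ^ 2 / r + t / T * (η * r ^ 2)) := by field_simp
  have k7 : t / T * (η * r ^ 2) ≤ 1 * (η * r ^ 2) := by
    gcongr
    rw [div_le_one hT]; exact htT
  have k8 : ‖x‖ ^ 3 / r ≤ t * T ^ 2 / r := by
    gcongr
    calc ‖x‖ ^ 3 ≤ t ^ 3 := by gcongr
      _ = t * t ^ 2 := by ring
      _ ≤ _ := by gcongr
  have t1 : 0 ≤ t * b ^ 2 / T := by positivity
  have t2 : 0 ≤ t * T ^ 2 / r := by positivity
  have t7 : 0 ≤ η * r ^ 2 := by positivity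
  rw [C3]
  exact alg4 k2 k3 k4 (k5.trans_eq k6) k7 k8 t1 t2 t7


theorem Good.slab {ν : Measure (E 4)} {η R : ℝ} (h : Good ν η R) (hη : η ≤ wD) {d t w : ℝ}
    (hd : 0 < d) (hdt : d ≤ 8 * t) (htR : 640 * t ≤ R) (hw : 2 * w ≤ wD) {n : E 4} (hn : ‖n‖ = 1)
    (hs : ∀ x ∈ msupp ν, ‖x‖ ≤ 10 * t → |⟪n, x⟫| ≤ w * d ∨ |⟪n, x⟫ - d| ≤ w * d) :
    Str ν n t (w * d) := by
  intro z hz hzt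
  by_contra hc
  have ht : 0 < t := by linarith
  have hwD1 : wD ≤ 1 / 100 := by unfold wD; norm_num
  have hwDe : wD ≤ eH * eH := by unfold wD eH; norm_num
  have hwDe' : wD ≤ eH := by unfold wD eH; norm_num
  have heH := eH_pos
  have heH1 : eH ≤ 1 / 100 := by unfold eH; norm_num
  have hηH : η ≤ eH := hη.trans hwDe'
  have hw2 : 2 * (w * d) ≤ wD * d := by
    have := mul_le_mul_of_nonneg_right hw hd.le
    linarith
  have hw3 : wD * d ≤ 1 / 100 * d := by gcongr
  have hw4 : wD * d ≤ eH * eH * d := by gcongr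
  have hw5 : wD * d ≤ eH * d := by gcongr
  have heHd : eH * d ≤ 1 / 100 * d := by gcongr
  have hz1 : |⟪n, z⟫ - d| ≤ w * d := (hs z hz (by linarith)).resolve_left hc
  obtain ⟨hz2, hz3⟩ := abs_le.1 hz1
  set p : E 4 := z - ⟪n, z⟫ • n with hp
  have hnp : ⟪n, p⟫ = 0 := by
    rw [hp, inner_sub_right, real_inner_smul_right, real_inner_self_eq_norm_sq, hn]; ring
  have hpz : ‖p‖ ≤ t := by
    refine le_trans (abs_le_of_sq_le_sq' ?_ (norm_nonneg z)).2 hzt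
    rw [hp, norm_sub_sq_real, norm_smul, real_inner_smul_right, hn, real_inner_comm, Real.norm_eq_abs,
      mul_one, sq_abs]
    nlinarith [sq_nonneg ⟪n, z⟫]
  have hzp : ‖z - p‖ ≤ d + w * d := by
    rw [hp, sub_sub_cancel, norm_smul, hn, mul_one, Real.norm_eq_abs, abs_of_nonneg (by linarith)]
    linarith
  set S0 : Set (E 4) := {x | x ∈ msupp ν ∧ ‖x‖ ≤ 10 * t ∧ |⟪n, x⟫| ≤ w * d} with hS0
  have hwd0 : 0 ≤ w * d := (abs_nonneg _).trans hz1
  have h00 : (0 : E 4) ∈ S0 := ⟨h.zero, by simp; linarith, by simpa using hwd0⟩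
  have c1 : IsClosed {x : E 4 | ‖x‖ ≤ 10 * t} := isClosed_le (by fun_prop) (by fun_prop)
  have c2 : IsClosed {x : E 4 | |⟪n, x⟫| ≤ w * d} := isClosed_le (by fun_prop) (by fun_prop)
  have hcl : IsClosed S0 := by
    refine (msupp_closed ν).inter (IsClosed.inter ?_ ?_)
    · exact c1
    · exact c2
  obtain ⟨y, hy, hyd⟩ := hcl.exists_infDist_eq_dist ⟨0, h00⟩ p
  have hmin : ∀ u ∈ S0, ‖p - y‖ ≤ ‖u - p‖ := by
    intro u hu
    have := infDist_le_dist_of_mem (x := p) hu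
    rw [hyd, dist_eq_norm, dist_eq_norm] at this
    rwa [norm_sub_rev u]
  have hyp : ‖p - y‖ ≤ t := by
    have := hmin 0 h00
    rw [zero_sub, norm_neg] at this
    linarith
  have hyt : ‖y‖ ≤ 2 * t := by
    have : y = p - (p - y) := by abel
    rw [this]
    exact (norm_sub_le _ _).trans (by linarith)
  obtain ⟨hy1, hy2, hy3⟩ := hy
  obtain ⟨hy4, hy5⟩ := abs_le.1 hy3
  have nbr : ∀ u ∈ msupp ν, ‖u - y‖ ≤ d / 2 → u ∈ S0 := by
    intro u hu huy
    have e1 : ‖u‖ ≤ 10 * t := by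
      have : u = (u - y) + y := by abel
      rw [this]
      exact (norm_add_le _ _).trans (by linarith)
    refine ⟨hu, e1, (hs u hu e1).resolve_right (fun hc' => ?_)⟩
    have e2 : |⟪n, u - y⟫| ≤ d / 2 := (abs_real_inner_le_norm _ _).trans (by rw [hn]; linarith)
    rw [inner_sub_right] at e2
    have e3 := (abs_le.1 e2).2
    have e4 := (abs_le.1 hc').1
    linarith
  have nbr2 : ∀ u ∈ msupp ν, ‖u - y‖ ≤ d / 2 → |⟪n, u - y⟫| ≤ 2 * (w * d) := by
    intro u hu huy
    have e1 := abs_le.1 (nbr u hu huy).2.2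
    rw [inner_sub_right, abs_le]
    constructor <;> linarith [e1.1, e1.2]
  rcases le_or_gt d ‖p - y‖ with hcase | hcase
  · refine h.NP hηH (σ := eH * d) (by positivity) (by linarith) hn hy1 (by linarith) (p := p)
      (by gcongr) ?_ ?_
    · rw [inner_sub_right, hnp, zero_sub, abs_neg]
      have : eH * d ≤ eH * ‖p - y‖ := by gcongr
      linarith
    · intro u hu huy
      have e0 : ‖u - y‖ ≤ d / 2 := by linarith
      exact ⟨(nbr2 u hu e0).trans (by linarith), hmin u (nbr u hu e0)⟩
  · have := (h.tr hy1 (by linarith)).Dlem hη hd (by linarith) hn (z := z - y) ?_ ?_ ?_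
    · rw [inner_sub_right] at this
      have := (abs_lt.1 this).2
      linarith
    · intro x hx hxd
      rw [mem_msupp_tr] at hx
      have := nbr2 _ hx (by simpa using hxd)
      rw [add_sub_cancel_left] at this
      linarith
    · rw [mem_msupp_tr]; simpa using hz
    · have : z - y = (z - p) + (p - y) := by abel
      rw [this]
      exact (norm_add_le _ _).trans (by linarith)


/-- large scale ratio -/
def M1 : ℝ := 10 ^ 120

theorem abs_sq_ineq {a b h k : ℝ} (ha : 1 / 2 ≤ a) (hk : 0 ≤ k) (hb0 : 0 ≤ b) (hbk : b ≤ k)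
    (h1 : |a * h ^ 2 - b * h| ≤ k ^ 2) : |h| ≤ 4 * k := by
  by_contra hc
  push Not at hc
  have h2 := (abs_le.1 h1).2
  have h3 : b * h ≤ k * |h| := by
    calc b * h ≤ b * |h| := by gcongr; exact le_abs_self h
      _ ≤ _ := by gcongr
  have h4 : 1 / 2 * |h| ^ 2 ≤ a * h ^ 2 := by rw [sq_abs]; gcongr
  nlinarith

theorem slab_alg {d h w : ℝ} (hd : 0 < d) (h1 : |h| * |h - d| ≤ w / 2 * d ^ 2) :
    |h| ≤ w * d ∨ |h - d| ≤ w * d := by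
  rcases le_or_gt (d / 2) |h| with h2 | h2
  · right
    have : d / 2 * |h - d| ≤ d / 2 * (w * d) := by
      calc d / 2 * |h - d| ≤ |h| * |h - d| := by gcongr
        _ ≤ _ := h1
        _ = _ := by ring
    exact le_of_mul_le_mul_left this (by positivity)
  · left
    have h3 : d / 2 ≤ |h - d| := by
      rw [abs_sub_comm]
      have := abs_sub_abs_le_abs_sub d h
      rw [abs_of_pos hd] at this
      linarith
    have : d / 2 * |h| ≤ d / 2 * (w * d) := by
      calc d / 2 * |h| ≤ |h - d| * |h| := by gcongr
        _ = |h| * |h - d| := by ring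
        _ ≤ _ := h1
        _ = _ := by ring
    exact le_of_mul_le_mul_left this (by positivity)

theorem Good.S1 {ν : Measure (E 4)} {η R : ℝ} (h : Good ν η R) (hη : η ≤ wD) {n : E 4} (hn : ‖n‖ = 1)
    {a b r M t : ℝ} (ha : 1 / 2 ≤ a) (haa : a ≤ 1) (hr : 0 < r) (hb : 0 ≤ b) (hP : Par ν n a b r η) (hM : M1 ≤ M)
    (ht : 0 < t) (hbt : b < 4 * t) (h1 : 1000 * M ^ 5 * t ≤ r) (h2 : η * r ^ 2 ≤ t ^ 2 / M ^ 3)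
    (htR : 640 * t ≤ R) (hs : Str ν n (30 * M * t) (cS * (10 * M * t))) :
    Str ν n t (100 * C3 / M * t) := by
  have hC : C3 = 10 ^ 5 := rfl
  have hM2 : (10 : ℝ) ^ 120 ≤ M := hM
  have hM0 : 0 < M := lt_of_lt_of_le (by norm_num) hM2
  have hM3 : 1 ≤ M := le_trans (by norm_num) hM2
  have h60 : 6 * (10 * M * t) ≤ r := by
    have : M ≤ M ^ 5 := le_self_pow₀ hM3 (by norm_num)
    have : M * t ≤ M ^ 5 * t := by gcongr
    have : 0 ≤ M * t := by positivity
    linarith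
  have key : ∀ x ∈ msupp ν, ‖x‖ ≤ 10 * t →
      |a * ⟪n, x⟫ ^ 2 - b * ⟪n, x⟫| ≤ C3 * (b ^ 2 / M + 2 * (t ^ 2 / M ^ 3)) := by
    intro x hx hxt
    refine (hP (10 * t) (10 * M * t) (by positivity) (by nlinarith) h60 (hs.mono (by linarith) le_rfl)
      x hx hxt).trans ?_
    have e1 : 10 * t * b ^ 2 / (10 * M * t) = b ^ 2 / M := by field_simp
    have e2 : 10 * t * (10 * M * t) ^ 2 / r ≤ t ^ 2 / M ^ 3 := by
      rw [div_le_div_iff₀ hr (by positivity)]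
      calc 10 * t * (10 * M * t) ^ 2 * M ^ 3 = t ^ 2 * (1000 * M ^ 5 * t) := by ring
        _ ≤ _ := by gcongr
    rw [e1, hC]
    linarith
  rcases le_or_gt b (t / M) with hc | hc
  · intro x hx hxt
    have h3 : |⟪n, x⟫| ≤ 4 * (t / M) := by
      refine abs_sq_ineq ha (by positivity) hb hc ((key x hx (by linarith)).trans ?_)
      have e1 : b ^ 2 / M ≤ (t / M) ^ 2 / M := by gcongr
      have e2 : (t / M) ^ 2 / M = t ^ 2 / M ^ 3 := by field_simp
      have e3 : C3 * (3 * (t ^ 2 / M ^ 3)) ≤ (t / M) ^ 2 := by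
        rw [div_pow, ← mul_div_assoc, ← mul_div_assoc, div_le_div_iff₀ (by positivity) (by positivity)]
        have : C3 * 3 ≤ M := by rw [hC]; linarith
        calc C3 * (3 * t ^ 2) * M ^ 2 = (C3 * 3) * (t ^ 2 * M ^ 2) := by ring
          _ ≤ M * (t ^ 2 * M ^ 2) := by gcongr
          _ = _ := by ring
      rw [hC] at e3 ⊢
      linarith
    refine h3.trans ?_
    have : 0 ≤ t / M := by positivity
    have e : 100 * C3 / M * t = 100 * C3 * (t / M) := by ring
    rw [e, hC]
    linarith
  · have hb0 : 0 < b := lt_of_le_of_lt (by positivity) hc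
    have ha1 : 0 < a := by linarith
    have hd : 0 < b / a := by positivity
    have hd2 : b / a ≤ 2 * b := by rw [div_le_iff₀ ha1]; nlinarith
    have hw : 2 * (12 * C3 / M) ≤ wD := by
      rw [← mul_div_assoc, div_le_iff₀ hM0]
      calc 2 * (12 * C3) ≤ wD * M1 := by unfold wD M1 C3; norm_num
        _ ≤ _ := by gcongr; exact wD_pos.le
    refine Str.mono (h.slab hη (t := t) hd (by linarith) htR hw hn ?_) le_rfl ?_
    · intro x hx hxt
      apply slab_alg hd
      have k := key x hx hxt
      have e1 : t ^ 2 / M ^ 3 ≤ b ^ 2 / M := by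
        rw [div_le_div_iff₀ (by positivity) hM0]
        have : t ≤ b * M := ((div_lt_iff₀ hM0).1 hc).le
        calc t ^ 2 * M ≤ (b * M) ^ 2 * M := by gcongr
          _ = _ := by ring
      have e2 : |a * ⟪n, x⟫ ^ 2 - b * ⟪n, x⟫| = a * (|⟪n, x⟫| * |⟪n, x⟫ - b / a|) := by
        rw [← abs_mul, ← abs_of_pos ha1, ← abs_mul, abs_of_pos ha1]
        congr 1
        field_simp
      rw [e2] at k
      have e3 : b ^ 2 / M = a ^ 2 * ((b / a) ^ 2 / M) := by field_simp
      rw [e3] at e1 k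
      have e4 : 12 * C3 / M / 2 * (b / a) ^ 2 = 6 * C3 * ((b / a) ^ 2 / M) := by ring
      rw [e4]
      have hD : 0 ≤ (b / a) ^ 2 / M := by positivity
      generalize (b / a) ^ 2 / M = D at *
      have e5 : a * (|⟪n, x⟫| * |⟪n, x⟫ - b / a|) ≤ a * (6 * C3 * D) := by
        have : a * (a * D) ≤ a * (1 * D) := by gcongr
        rw [hC] at k ⊢
        nlinarith
      exact le_of_mul_le_mul_left e5 ha1
    · have : 12 * C3 / M * (b / a) ≤ 12 * C3 / M * (8 * t) := by
        have : 0 ≤ 12 * C3 / M := by rw [hC]; positivity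
        gcongr
        linarith
      refine this.trans ?_
      have : 0 ≤ C3 / M * t := by rw [hC]; positivity
      calc 12 * C3 / M * (8 * t) = 96 * (C3 / M * t) := by ring
        _ ≤ 100 * (C3 / M * t) := by linarith
        _ = _ := by ring

theorem Good.S2 {ν : Measure (E 4)} {η : ℝ} {n : E 4} (hn : ‖n‖ = 1)
    {a b r T t : ℝ} (ha : 1 / 2 ≤ a) (ha1 : a ≤ 1) (hP : Par ν n a b r η)
    (ht : 0 < t) (hbt : 4 * t ≤ b) (htT : t ≤ T) (hT : 6 * T ≤ r) (hs : Str ν n (3 * T) (cS * T)) :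
    Str ν n t (2 * C3 * (t * b / T + t * T ^ 2 / (r * b) + η * r ^ 2 / b)) := by
  intro x hx hxt
  have hb : 0 < b := by linarith
  have k := hP t T ht htT hT hs x hx hxt
  have h1 : |⟪n, x⟫| ≤ t := (abs_real_inner_le_norm _ _).trans (by rw [hn]; linarith)
  have h2 : b / 2 ≤ |a * ⟪n, x⟫ - b| := by
    rw [abs_sub_comm]
    refine le_trans ?_ (le_abs_self _)
    have : a * ⟪n, x⟫ ≤ 1 * t := by
      calc a * ⟪n, x⟫ ≤ a * |⟪n, x⟫| := by gcongr; exact le_abs_self _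
        _ ≤ _ := by gcongr
    linarith
  have e2 : |a * ⟪n, x⟫ ^ 2 - b * ⟪n, x⟫| = |⟪n, x⟫| * |a * ⟪n, x⟫ - b| := by
    rw [← abs_mul]; congr 1; ring
  rw [e2] at k
  have h3 : |⟪n, x⟫| * (b / 2) ≤ C3 * (t * b ^ 2 / T + t * T ^ 2 / r + η * r ^ 2) :=
    le_trans (by gcongr) k
  have h4 : C3 * (t * b ^ 2 / T + t * T ^ 2 / r + η * r ^ 2) =
    (2 * C3 * (t * b / T + t * T ^ 2 / (r * b) + η * r ^ 2 / b)) * (b / 2) := by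
    field_simp
  rw [h4] at h3
  exact le_of_mul_le_mul_right h3 (by positivity)


theorem Good.mom_strip {ν : Measure (E 4)} {η R : ℝ} (h : Good ν η R) {r q : ℝ} (hr : 0 < r)
    (hrR : 2 * r ≤ R) (hq : 0 < q) {n : E 4} (hn : ‖n‖ = 1) (hQ : QQ ν r n ≤ q ^ 5 / 13) :
    Str ν n (r / 2) (q * r) := by
  intro x hx hxr
  by_contra hc
  push Not at hc
  set H := |⟪n, x⟫| with hH
  have hH0 : 0 < H := lt_trans (by positivity) hc
  have hHr : H ≤ r / 2 := (abs_real_inner_le_norm _ _).trans (by rw [hn]; linarith)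
  have sub : closedBall x (H / 2) ⊆ closedBall (0 : E 4) r := by
    apply closedBall_subset_closedBall'
    rw [dist_zero_right]; linarith
  have h1 : ∫ _ in closedBall x (H / 2), (H / 2) ^ 2 ∂ν ≤ ∫ w in closedBall x (H / 2), ⟪n, w⟫ ^ 2 ∂ν := by
    refine setIntegral_mono_on (h.int (by fun_prop) x _) (h.int (by fun_prop) x _)
      measurableSet_closedBall (fun w hw => ?_)
    rw [mem_closedBall, dist_eq_norm] at hw
    have e1 : |⟪n, x⟫ - ⟪n, w⟫| ≤ H / 2 := by
      rw [← inner_sub_right]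
      exact (abs_real_inner_le_norm _ _).trans (by rw [hn, norm_sub_rev]; linarith)
    have e2 : H / 2 ≤ |⟪n, w⟫| := by
      have := abs_sub_abs_le_abs_sub ⟪n, x⟫ ⟪n, w⟫
      linarith
    calc (H / 2) ^ 2 ≤ |⟪n, w⟫| ^ 2 := by gcongr
      _ = _ := sq_abs _
  have h2 : ∫ w in closedBall x (H / 2), ⟪n, w⟫ ^ 2 ∂ν ≤ ∫ w in closedBall (0 : E 4) r, ⟪n, w⟫ ^ 2 ∂ν :=
    setIntegral_mono_set (h.int (by fun_prop) 0 r) (ae_of_all _ (fun w => sq_nonneg _))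
      (LE.le.eventuallyLE sub)
  have h3 := h.lo hx (by linarith) (t := H / 2) (by positivity) (by linarith)
  have h4 : ∫ _ in closedBall x (H / 2), (H / 2) ^ 2 ∂ν = ν.real (closedBall x (H / 2)) * (H / 2) ^ 2 := by
    simp
  have h5 : (H / 2) ^ 3 / 2 * (H / 2) ^ 2 ≤ ∫ w in closedBall (0 : E 4) r, ⟪n, w⟫ ^ 2 ∂ν := by
    refine le_trans ?_ (h1.trans h2)
    rw [h4]; gcongr
  have h6 : 5 / r ^ 5 * ((H / 2) ^ 3 / 2 * (H / 2) ^ 2) ≤ q ^ 5 / 13 := by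
    refine le_trans ?_ hQ
    unfold QQ
    gcongr
  have h7 : 5 / r ^ 5 * ((H / 2) ^ 3 / 2 * (H / 2) ^ 2) = 5 / 64 * (H ^ 5 / r ^ 5) := by
    field_simp; norm_num
  have h8 : q ^ 5 < H ^ 5 / r ^ 5 := by
    rw [lt_div_iff₀ (by positivity), ← mul_pow]
    gcongr
  have : 0 < q ^ 5 := by positivity
  linarith

theorem Good.mom_bet {ν : Measure (E 4)} {η R : ℝ} (h : Good ν η R) {r κ : ℝ} (hr : 0 < r)
    (hrR : r ≤ R) (hκ : 0 < κ) {n : E 4} (hQ : QQ ν r n ≤ κ ^ 2) :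
    ⟪bet ν r, n⟫ ≤ 6 * κ * r := by
  have h1 : ∫ w in closedBall (0 : E 4) r, (r ^ 2 - ‖w‖ ^ 2) * ⟪n, w⟫ ∂ν ≤
      ∫ w in closedBall (0 : E 4) r, (r ^ 2 * (κ * r / 2) + r / (2 * κ) * ⟪n, w⟫ ^ 2) ∂ν :=
    h.int_le (by fun_prop) (by fun_prop) r (fun x hx hxr => by
      have h4 : 0 ≤ r ^ 2 - ‖x‖ ^ 2 := by nlinarith [norm_nonneg x]
      have h5 : (r ^ 2 - ‖x‖ ^ 2) * ⟪n, x⟫ ≤ r ^ 2 * |⟪n, x⟫| := by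
        calc _ ≤ (r ^ 2 - ‖x‖ ^ 2) * |⟪n, x⟫| := by gcongr; exact le_abs_self _
          _ ≤ _ := by gcongr; linarith [sq_nonneg ‖x‖]
      refine h5.trans ?_
      have h6 : r ^ 2 * (κ * r / 2) + r / (2 * κ) * ⟪n, x⟫ ^ 2 - r ^ 2 * |⟪n, x⟫| =
        r / (2 * κ) * (|⟪n, x⟫| - κ * r) ^ 2 := by
        rw [← sq_abs ⟪n, x⟫]
        field_simp; ring
      have : 0 ≤ r / (2 * κ) * (|⟪n, x⟫| - κ * r) ^ 2 := by positivity
      linarith)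
  rw [integral_add (h.int (by fun_prop) 0 r) (h.int (by fun_prop) 0 r), Good.int_const,
    integral_const_mul] at h1
  have h2 := h.up0 hr hrR
  rw [h.inner_bet]
  calc _ ≤ 5 / r ^ 5 * (2 * r ^ 3 * (r ^ 2 * (κ * r / 2)) + r / (2 * κ) *
        ∫ w in closedBall (0 : E 4) r, ⟪n, w⟫ ^ 2 ∂ν) := by
        gcongr
        exact h1.trans (by gcongr)
    _ = 5 * κ * r + r / (2 * κ) * QQ ν r n := by unfold QQ; field_simp
    _ ≤ 5 * κ * r + r / (2 * κ) * κ ^ 2 := by gcongr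
    _ = 5.5 * κ * r := by field_simp; norm_num
    _ ≤ _ := by gcongr; norm_num

/-- first scale -/
def m1 : ℝ := 1 / (1000 * M1 ^ 5)

theorem M1_pos : 0 < M1 := by unfold M1; norm_num
theorem M1_big : 1000 ≤ M1 := by unfold M1; norm_num
theorem m1_pos : 0 < m1 := by unfold m1; have := M1_pos; positivity
theorem m1_le : m1 ≤ 1 / 1000 := by
  unfold m1
  have : 1 ≤ M1 ^ 5 := one_le_pow₀ (by linarith [M1_big])
  apply one_div_le_one_div_of_le <;> linarith
theorem cS_M1 : 100 * C3 / M1 ≤ cS / 3 := by unfold C3 M1 cS eH; norm_num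

theorem M1_scales : 30 * M1 * m1 ≤ 1 / 2 := by
  unfold m1
  have h := M1_big
  have h2 : M1 ≤ M1 ^ 5 := le_self_pow₀ (by linarith) (by norm_num)
  rw [mul_one_div, div_le_iff₀ (by positivity)]
  linarith

theorem Good.induct {ν : Measure (E 4)} {η R : ℝ} (h : Good ν η R) (hη : η ≤ wD) {n : E 4} (hn : ‖n‖ = 1)
    {a b r τ : ℝ} (ha : 1 / 2 ≤ a) (ha1 : a ≤ 1) (hr : 0 < r) (hb : 0 ≤ b) (hP : Par ν n a b r η)
    (hR : 640 * r ≤ R) (hτ : 0 < τ) (hητ : η ≤ τ ^ 2 / M1 ^ 3)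
    (h0 : Str ν n (r / 2) (cS / 3 * m1 * r)) (hb1 : M1 ^ 3 * b ≤ r) :
    ∀ u, τ * r ≤ u → u ≤ r / 2 → Str ν n u (cS / 3 * u) := by
  have hM := M1_big
  have hM0 := M1_pos
  have hcS := cS_pos
  have hcM := cS_M1
  have hC : C3 = 10 ^ 5 := rfl
  have claim : ∀ k : ℕ, ∀ u, τ * r ≤ u → u ≤ r / 2 → r / 2 ≤ u * 2 ^ k → Str ν n u (cS / 3 * u) := by
    intro k
    have big : ∀ u, m1 * r ≤ u → u ≤ r / 2 → Str ν n u (cS / 3 * u) := by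
      intro u hu hur
      refine h0.mono hur ?_
      rw [mul_assoc]
      gcongr
    induction k with
    | zero =>
      intro u _ hur hk
      refine big u ?_ hur
      have := m1_le
      nlinarith
    | succ k ih =>
      intro u hτu hur hk
      rcases le_or_gt (m1 * r) u with hc | hc
      · exact big u hc hur
      have hu : 0 < u := lt_of_lt_of_le (by positivity) hτu
      have ih2 : ∀ u', 2 * u ≤ u' → u' ≤ r / 2 → Str ν n u' (cS / 3 * u') := by
        intro u' h1 h2
        refine ih u' (by linarith) h2 (hk.trans ?_)
        rw [pow_succ]
        have : 2 * u * 2 ^ k ≤ u' * 2 ^ k := by gcongr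
        linarith
      have hηu : η * r ^ 2 ≤ u ^ 2 / M1 ^ 3 := by
        calc η * r ^ 2 ≤ τ ^ 2 / M1 ^ 3 * r ^ 2 := by gcongr
          _ = (τ * r) ^ 2 / M1 ^ 3 := by ring
          _ ≤ _ := by gcongr
      have hur' : 1000 * M1 ^ 5 * u ≤ r := by
        have : 1000 * M1 ^ 5 * u ≤ 1000 * M1 ^ 5 * (m1 * r) := by gcongr
        refine this.trans (le_of_eq ?_)
        unfold m1
        field_simp
      rcases lt_or_ge b (4 * u) with hbu | hbu
      · refine (h.S1 hη hn ha ha1 hr hb hP le_rfl hu hbu hur' hηu (by linarith) ?_).mono le_rfl (by gcongr)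
        refine (ih2 (30 * M1 * u) (by nlinarith) ?_).mono le_rfl (le_of_eq (by ring))
        calc 30 * M1 * u ≤ 30 * M1 * (m1 * r) := by gcongr
          _ = 30 * M1 * m1 * r := by ring
          _ ≤ 1 / 2 * r := by gcongr; exact M1_scales
          _ = _ := by ring
      · have hb0 : 0 < b := by linarith
        have hT : 6 * (M1 * b) ≤ r := by
          refine le_trans ?_ hb1
          have : 6 ≤ M1 ^ 2 := by nlinarith
          calc 6 * (M1 * b) ≤ M1 ^ 2 * (M1 * b) := by gcongr
            _ = _ := by ring
        have hub : u ≤ M1 * b := by nlinarith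
        refine (Good.S2 hn ha ha1 hP hu hbu (T := M1 * b) hub hT ?_).mono le_rfl ?_
        · refine (ih2 (3 * (M1 * b)) (by linarith) (by linarith)).mono le_rfl (le_of_eq (by ring))
        · have e1 : u * b / (M1 * b) = u / M1 := by field_simp
          have e2 : u * (M1 * b) ^ 2 / (r * b) ≤ u / M1 := by
            rw [div_le_div_iff₀ (by positivity) hM0]
            calc u * (M1 * b) ^ 2 * M1 = u * b * (M1 ^ 3 * b) := by ring
              _ ≤ u * b * r := by gcongr
              _ = _ := by ring
          have e3 : η * r ^ 2 / b ≤ u / M1 := by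
            calc η * r ^ 2 / b ≤ u ^ 2 / M1 ^ 3 / (4 * u) := by gcongr
              _ = u / M1 * (1 / (4 * M1 ^ 2)) := by field_simp
              _ ≤ u / M1 * 1 := by
                gcongr
                rw [div_le_one (by positivity)]
                nlinarith
              _ = _ := by ring
          rw [e1]
          have e4 : 0 ≤ u / M1 := by positivity
          calc _ ≤ 2 * C3 * (u / M1 + u / M1 + u / M1) := by
                have : 0 ≤ C3 := by rw [hC]; norm_num
                gcongr
            _ ≤ 100 * C3 / M1 * u := by
                have : 100 * C3 / M1 * u = 100 * C3 * (u / M1) := by ring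
                rw [this, hC]
                linarith
            _ ≤ _ := by gcongr
  intro u hu hur
  have hu0 : 0 < u := lt_of_lt_of_le (by positivity) hu
  obtain ⟨k, hk⟩ := pow_unbounded_of_one_lt (r / 2 / u) (one_lt_two)
  refine claim k u hu hur ?_
  rw [div_lt_iff₀ hu0] at hk
  linarith


/-- strip width at the first scale -/
def qq : ℝ := cS / 3 * m1

/-- flatness threshold -/
def eps1 : ℝ := (qq ^ 5 / 10) ^ 2

/-- scale ratio -/
def tau (M : ℝ) : ℝ := 1 / (1000 * M ^ 5)

/-- density threshold -/
def etaM (M : ℝ) : ℝ := tau M ^ 2 / M ^ 3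

theorem qq_pos : 0 < qq := by unfold qq; have := cS_pos; have := m1_pos; positivity
theorem eps1_pos : 0 < eps1 := by unfold eps1; have := qq_pos; positivity
theorem qq_M1 : M1 ^ 3 * qq ≤ 1 := by
  unfold qq m1 cS eH M1
  norm_num
theorem qq_le : qq ≤ 1 := by
  have := qq_M1
  have h2 : 1 ≤ M1 ^ 3 := one_le_pow₀ (by linarith [M1_big])
  have := qq_pos
  nlinarith

theorem tau_pos {M : ℝ} (hM : M1 ≤ M) : 0 < tau M := by
  have := M1_pos
  have : 0 < M := by linarith
  unfold tau; positivity

theorem tau_mul {M : ℝ} (hM : M1 ≤ M) : 1000 * M ^ 5 * tau M = 1 := by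
  have := M1_pos
  have : 0 < M := by linarith
  unfold tau; field_simp

theorem tau_pow {M : ℝ} (hM : M1 ≤ M) {k : ℕ} (hk : k ≤ 4) : 1000 * (M ^ k * tau M) ≤ 1 / M := by
  have h1 := M1_big
  have h0 : 0 < M := by linarith
  rw [le_div_iff₀ h0]
  have e : 1000 * (M ^ k * tau M) * M = 1000 * M ^ (k + 1) * tau M := by ring
  rw [e]
  refine le_trans ?_ (tau_mul hM).le
  have := tau_pos hM
  gcongr
  · linarith
  · omega

theorem etaM_pos {M : ℝ} (hM : M1 ≤ M) : 0 < etaM M := by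
  have := M1_pos
  have : 0 < M := by linarith
  have := tau_pos hM
  unfold etaM; positivity

theorem etaM_wD {M : ℝ} (hM : M1 ≤ M) : etaM M ≤ wD := by
  have h1 := M1_big
  have h0 : 0 < M := by linarith
  have h2 := tau_pow hM (k := 0) (by norm_num)
  rw [pow_zero, one_mul] at h2
  have h3 := tau_pos hM
  have h4 : 1 / M ≤ wD := by
    rw [div_le_iff₀ h0]
    have : wD * M1 ≤ wD * M := by gcongr; exact wD_pos.le
    refine le_trans ?_ this
    unfold wD M1; norm_num
  have h5 : 1 / M ≤ 1 := by rw [div_le_one h0]; linarith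
  have h6 : tau M ^ 2 ≤ wD := by nlinarith
  unfold etaM
  rw [div_le_iff₀ (by positivity)]
  have : 1 ≤ M ^ 3 := one_le_pow₀ (by linarith)
  nlinarith [wD_pos]

theorem Good.low {ν : Measure (E 4)} {r : ℝ} (e : OrthonormalBasis (Fin 4) ℝ (E 4)) (l : Fin 4 → ℝ)
    (hQ : ∀ x, QQ ν r x = ∑ i, l i * ⟪e i, x⟫ ^ 2) (hl : Antitone l) {n0 : E 4} (hn0 : ‖n0‖ = 1) :
    QQ ν r (e 3) ≤ QQ ν r n0 := by
  have h3 : QQ ν r (e 3) = l 3 := by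
    rw [hQ, Finset.sum_eq_single 3]
    · simp
    · intro j _ hj
      rw [e.orthonormal.2 hj]; simp
    · simp
  have h4 : l 3 = ∑ i, l 3 * ⟪e i, n0⟫ ^ 2 := by
    rw [Fin.sum_univ_four, ← mul_add, ← mul_add, ← mul_add, ← norm_sq_onb e, hn0]; ring
  rw [h3, h4, hQ]
  refine Finset.sum_le_sum (fun i _ => ?_)
  gcongr
  exact hl (Fin.le_last i)

set_option maxHeartbeats 1000000 in
theorem Good.L7 {ν : Measure (E 4)} {η R : ℝ} (h : Good ν η R) {r M : ℝ} (hr : 0 < r)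
    (hR : 1000 * r ≤ R) (hM : M1 ≤ M) (hη : η ≤ etaM M) {n0 : E 4} (hn0 : ‖n0‖ = 1)
    (hQ0 : QQ ν r n0 ≤ eps1) :
    ∃ n : E 4, ‖n‖ = 1 ∧ Str ν n (tau M * r) (250 * C3 / M * (tau M * r)) := by
  have hM1 := M1_big
  have hM0 : 0 < M := by linarith
  have hM10 := M1_pos
  have hη0 := h.eta0
  have hwD := hη.trans (etaM_wD hM)
  have hηH : η ≤ eH := hwD.trans (by unfold wD eH; norm_num)
  have hC : C3 = 10 ^ 5 := rfl
  have hτ := tau_pos hM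
  have hq := qq_pos
  have hq1 := qq_le
  obtain ⟨e, l, hQ, hl, hb⟩ := h.spec r
  have hQ3 := (Good.low e l hQ hl hn0).trans hQ0
  have hl3 : QQ ν r (e 3) = l 3 := by
    rw [hQ, Finset.sum_eq_single 3]
    · simp
    · intro j _ hj
      rw [e.orthonormal.2 hj]; simp
    · simp
  have hq5 : qq ^ 5 ≤ 1 := pow_le_one₀ hq.le hq1
  have hq50 : 0 < qq ^ 5 := by positivity
  have hl0 : 0 ≤ l 3 := by rw [← hl3]; exact Good.QQ_nonneg hr _
  have hl1 : l 3 ≤ 1 / 2 := by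
    rw [← hl3]; refine hQ3.trans ?_
    unfold eps1; nlinarith
  have hn : ‖e 3‖ = 1 := e.orthonormal.1 3
  have hP := h.par hηH hr (by linarith) e l hQ hl hl1
  set b := ⟪bet ν r, e 3⟫ with hbdef
  have hbq : b ≤ 6 * (qq ^ 5 / 10) * r := h.mom_bet hr (by linarith) (by positivity) hQ3
  have hb1 : M1 ^ 3 * b ≤ r := by
    have e1 : qq ^ 5 ≤ qq := pow_le_of_le_one hq.le hq1 (by norm_num)
    calc M1 ^ 3 * b ≤ M1 ^ 3 * (qq * r) := by gcongr; nlinarith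
      _ = M1 ^ 3 * qq * r := by ring
      _ ≤ 1 * r := by gcongr; exact qq_M1
      _ = r := one_mul r
  have h0 : Str ν (e 3) (r / 2) (cS / 3 * m1 * r) :=
    h.mom_strip hr (by linarith) (q := qq) hq hn (hQ3.trans (by unfold eps1; nlinarith))
  have hητ : η ≤ tau M ^ 2 / M1 ^ 3 := by
    refine hη.trans ?_
    unfold etaM
    gcongr
  have ind := h.induct hwD hn (a := 1 - l 3) (by linarith) (by linarith) hr hb hP (by linarith) hτ hητ h0 hb1
  set ρ := tau M * r with hρ
  have hρ0 : 0 < ρ := by positivity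
  have hηρ : η * r ^ 2 ≤ ρ ^ 2 / M ^ 3 := by
    calc η * r ^ 2 ≤ etaM M * r ^ 2 := by gcongr
      _ = _ := by rw [hρ, etaM]; ring
  have hMρ : 1000 * M ^ 5 * ρ = r := by rw [hρ, ← mul_assoc, tau_mul hM, one_mul]
  have hpow : ∀ k : ℕ, k ≤ 4 → 1000 * (M ^ k * ρ) ≤ r / M := by
    intro k hk
    calc 1000 * (M ^ k * ρ) = 1000 * (M ^ k * tau M) * r := by rw [hρ]; ring
      _ ≤ 1 / M * r := by gcongr; exact tau_pow hM hk
      _ = _ := by ring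
  have hrM : r / M ≤ r := div_le_self hr.le (by linarith)
  have hp0 := hpow 0 (by norm_num)
  have hp1 := hpow 1 (by norm_num)
  have hp2 := hpow 2 (by norm_num)
  have hM3 : 1 ≤ M ^ 3 := one_le_pow₀ (by linarith)
  have hM2 : 1 ≤ M ^ 2 := one_le_pow₀ (by linarith)
  rcases lt_or_ge b (4 * ρ) with hbρ | hbρ
  · refine ⟨e 3, hn, ?_⟩
    refine (h.S1 hwD hn (by linarith) (by linarith) hr hb hP hM hρ0 hbρ hMρ.le hηρ (by linarith) ?_).mono
      le_rfl ?_
    · refine (ind (30 * M * ρ) (by nlinarith) (by linarith)).mono le_rfl (le_of_eq (by ring))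
    · gcongr
      · rw [hC]; norm_num
      · norm_num
  rcases lt_or_ge b (M * ρ) with hbM | hbM
  · refine ⟨e 3, hn, ?_⟩
    have hb0 : 0 < b := by linarith
    refine (Good.S2 hn (by linarith) (by linarith) hP hρ0 hbρ (T := M ^ 2 * ρ) (by nlinarith)
      (by linarith) ?_).mono le_rfl ?_
    · refine (ind (3 * (M ^ 2 * ρ)) (by nlinarith) (by linarith)).mono le_rfl (le_of_eq (by ring))
    · have e1 : ρ * b / (M ^ 2 * ρ) ≤ ρ / M := by
        rw [div_le_div_iff₀ (by positivity) hM0]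
        calc ρ * b * M ≤ ρ * (M * ρ) * M := by gcongr
          _ = _ := by ring
      have e2 : ρ * (M ^ 2 * ρ) ^ 2 / (r * b) ≤ ρ / M := by
        rw [div_le_div_iff₀ (by positivity) hM0]
        calc ρ * (M ^ 2 * ρ) ^ 2 * M = ρ * (M ^ 5 * ρ) * ρ := by ring
          _ ≤ ρ * r * b := by
            gcongr
            · rw [← hMρ]; nlinarith [show 0 ≤ M ^ 5 * ρ by positivity]
            · linarith
          _ = _ := by ring
      have e3 : η * r ^ 2 / b ≤ ρ / M := by
        calc η * r ^ 2 / b ≤ ρ ^ 2 / M ^ 3 / (4 * ρ) := by gcongr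
          _ = ρ / M * (1 / (4 * M ^ 2)) := by field_simp
          _ ≤ ρ / M * 1 := by
            gcongr
            rw [div_le_one (by positivity)]
            linarith
          _ = _ := by ring
      have e4 : 0 ≤ ρ / M := by positivity
      calc _ ≤ 2 * C3 * (ρ / M + ρ / M + ρ / M) := by
            have : 0 ≤ C3 := by rw [hC]; norm_num
            gcongr
        _ ≤ 250 * C3 / M * ρ := by
            have : 250 * C3 / M * ρ = 250 * C3 * (ρ / M) := by ring
            rw [this, hC]
            linarith
  · have hbb : b ≤ ‖bet ν r‖ := (real_inner_le_norm _ _).trans (by rw [hn, mul_one])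
    have hB0 : 0 < ‖bet ν r‖ := lt_of_lt_of_le (by positivity) (hbM.trans hbb)
    refine ⟨‖bet ν r‖⁻¹ • bet ν r, by rw [norm_smul]; simp; field_simp, ?_⟩
    intro x hx hxρ
    have k := h.star_bet hr (by linarith) hx (by linarith)
    rw [real_inner_smul_left, abs_mul, abs_of_pos (by positivity), inv_mul_le_iff₀ hB0]
    have e1 : ‖x‖ ^ 2 ≤ ρ ^ 2 := by gcongr
    have e2 : ‖x‖ ^ 3 / r ≤ ρ ^ 2 := by
      rw [div_le_iff₀ hr]
      calc ‖x‖ ^ 3 ≤ ρ ^ 3 := by gcongr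
        _ = ρ ^ 2 * ρ := by ring
        _ ≤ _ := by gcongr; linarith
    have e3 : η * r ^ 2 ≤ ρ ^ 2 := hηρ.trans (div_le_self (by positivity) hM3)
    have e4 : M * ρ * (250 * C3 / M * ρ) ≤ ‖bet ν r‖ * (250 * C3 / M * ρ) := by
      have : 0 ≤ C3 := by rw [hC]; norm_num
      gcongr
      exact hbM.trans hbb
    refine le_trans ?_ e4
    have e5 : M * ρ * (250 * C3 / M * ρ) = 250 * C3 * ρ ^ 2 := by field_simp
    rw [e5, hC]
    nlinarith [sq_nonneg ρ]


/-- scale ratio for the iteration -/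
def M2 : ℝ := M1 + 1000 * C3 / (qq ^ 5 / 10)

theorem M2_ge : M1 ≤ M2 := by
  unfold M2
  have : 0 ≤ 1000 * C3 / (qq ^ 5 / 10) := by have := qq_pos; unfold C3; positivity
  linarith

theorem M2_eps : 10 * (250 * C3 / M2) ^ 2 ≤ eps1 := by
  have hq := qq_pos
  have h0 : 0 < qq ^ 5 / 10 := by positivity
  have hC : 0 < C3 := by unfold C3; norm_num
  have h1 : 1000 * C3 / (qq ^ 5 / 10) ≤ M2 := by unfold M2; linarith [M1_pos]
  have hM : 0 < M2 := by linarith [M1_pos, M2_ge]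
  have h2 : 1000 * C3 / M2 ≤ qq ^ 5 / 10 := by
    rw [div_le_iff₀ hM]
    rw [div_le_iff₀ h0] at h1
    linarith
  have h3 : 0 ≤ 1000 * C3 / M2 := by positivity
  have h4 : (1000 * C3 / M2) ^ 2 ≤ eps1 := by unfold eps1; gcongr
  have h5 : 1000 * C3 / M2 = 4 * (250 * C3 / M2) := by ring
  rw [h5] at h4
  nlinarith [sq_nonneg (250 * C3 / M2)]

theorem tau_lt {M : ℝ} (hM : M1 ≤ M) : tau M < 1 := by
  have h1 := M1_big
  have h2 := tau_pow hM (k := 0) (by norm_num)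
  have h3 : 1 / M ≤ 1 := by rw [div_le_one (by linarith)]; linarith
  linarith

theorem Good.iter {ν : Measure (E 4)} {η R : ℝ} (h : Good ν η R) {r : ℝ} (hr : 0 < r)
    (hR : 1000 * r ≤ R) (hη : η ≤ etaM M2) {n0 : E 4} (hn0 : ‖n0‖ = 1)
    (hQ0 : QQ ν r n0 ≤ eps1) (k : ℕ) :
    ∃ n : E 4, ‖n‖ = 1 ∧ QQ ν (tau M2 ^ k * r) n ≤ eps1 := by
  have hτ := tau_pos M2_ge
  have hτ1 := tau_lt M2_ge
  induction k with
  | zero => exact ⟨n0, hn0, by simpa using hQ0⟩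
  | succ k ih =>
    obtain ⟨n, hn, hQ⟩ := ih
    have hk : tau M2 ^ k * r ≤ r := by
      have : tau M2 ^ k ≤ 1 := pow_le_one₀ hτ.le hτ1.le
      nlinarith
    have hk1 : tau M2 ^ (k + 1) * r ≤ r := by
      have : tau M2 ^ (k + 1) ≤ 1 := pow_le_one₀ hτ.le hτ1.le
      nlinarith
    obtain ⟨n', hn', hs⟩ := h.L7 (r := tau M2 ^ k * r) (by positivity) (by linarith) M2_ge hη hn hQ
    refine ⟨n', hn', ?_⟩
    have e : tau M2 * (tau M2 ^ k * r) = tau M2 ^ (k + 1) * r := by ring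
    rw [e] at hs
    exact (h.QQ_strip (by positivity) (by linarith) hs).trans M2_eps

theorem flat_strips {ν : Measure (E 4)} {η R : ℝ} (h : Good ν η R) {r : ℝ} (hr : 0 < r)
    (hR : 1000 * r ≤ R) (hη : η ≤ etaM M2) {n0 : E 4} (hn0 : ‖n0‖ = 1)
    (hQ0 : QQ ν r n0 ≤ eps1) (hall : ∀ η', 0 < η' → η' ≤ 1 / 10 → ∃ R', Good ν η' R')
    {c : ℝ} (hc : 0 < c) : ∃ ρ0, 0 < ρ0 ∧ ∀ ρ, 0 < ρ → ρ ≤ ρ0 → ∃ n : E 4, ‖n‖ = 1 ∧ Str ν n ρ (c * ρ) := by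
  have hτ := tau_pos M2_ge
  have hτ1 := tau_lt M2_ge
  have hC : 0 < C3 := by unfold C3; norm_num
  set τ := tau M2 with hτd
  set M := M1 + 250 * C3 / (c * τ) with hM
  have hM1 : M1 ≤ M := by
    have : 0 ≤ 250 * C3 / (c * τ) := by positivity
    linarith
  have hM0 : 0 < M := by linarith [M1_pos]
  have hMc : 250 * C3 / M ≤ c * τ := by
    rw [div_le_iff₀ hM0, ← div_le_iff₀' (by positivity)]
    linarith [M1_pos]
  have hσ := tau_pos hM1
  obtain ⟨R', h'⟩ := hall (etaM M) (etaM_pos hM1) ((etaM_wD hM1).trans (by unfold wD; norm_num))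
  have hR' := h'.Rpos
  obtain ⟨k0, hk0⟩ := exists_pow_lt_of_lt_one (show 0 < R' / (1000 * r) by positivity) hτ1
  rw [lt_div_iff₀ (by positivity)] at hk0
  refine ⟨tau M * (τ ^ k0 * r), by positivity, fun ρ hρ hρ0 => ?_⟩
  have hx : 0 < ρ / (tau M * (τ ^ k0 * r)) := by positivity
  have hx1 : ρ / (tau M * (τ ^ k0 * r)) ≤ 1 := by rw [div_le_one (by positivity)]; exact hρ0
  obtain ⟨j, hj1, hj2⟩ := exists_nat_pow_near_of_lt_one hx hx1 hτ hτ1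
  rw [lt_div_iff₀ (by positivity)] at hj1
  rw [div_le_iff₀ (by positivity)] at hj2
  obtain ⟨n, hn, hQ⟩ := h.iter hr hR hη hn0 hQ0 (k0 + j)
  have hkj : τ ^ (k0 + j) * r ≤ τ ^ k0 * r := by
    rw [pow_add]
    have : τ ^ j ≤ 1 := pow_le_one₀ hτ.le hτ1.le
    have : τ ^ k0 * τ ^ j ≤ τ ^ k0 * 1 := by gcongr
    nlinarith
  obtain ⟨n', hn', hs⟩ := h'.L7 (r := τ ^ (k0 + j) * r) (by positivity) (by linarith) hM1 le_rfl hn hQ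
  refine ⟨n', hn', hs.mono ?_ ?_⟩
  · refine hj2.trans (le_of_eq ?_); ring
  · calc 250 * C3 / M * (tau M * (τ ^ (k0 + j) * r)) ≤ c * τ * (tau M * (τ ^ (k0 + j) * r)) := by gcongr
      _ = c * (τ ^ (j + 1) * (tau M * (τ ^ k0 * r))) := by ring
      _ ≤ _ := by gcongr

theorem Dxr_nonneg {n : ℕ} (x : E n) {r : ℝ} (hr : 0 < r) (A B : Set (E n)) : 0 ≤ Dxr x r A B := by
  refine le_max_of_le_left ?_
  unfold dxr setD
  refine mul_nonneg (by positivity) (Real.iSup_nonneg fun a => Real.iSup_nonneg fun _ => infDist_nonneg)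

theorem dxr_le {n : ℕ} {x : E n} {r c : ℝ} (hr : 0 < r) (hc : 0 ≤ c) {A B : Set (E n)}
    (h : ∀ a ∈ A, a ∈ closedBall x r → ∃ b ∈ B, b ∈ closedBall x r ∧ dist a b ≤ c * r) : dxr x r A B ≤ c := by
  unfold dxr setD
  rw [one_div, inv_mul_le_iff₀ hr, mul_comm]
  refine Real.iSup_le (fun a => Real.iSup_le (fun ha => ?_) (by positivity)) (by positivity)
  obtain ⟨b, hb, hb2, hd⟩ := h a ha.1 ha.2
  exact (infDist_le_dist_of_mem (show b ∈ B ∩ closedBall x r from ⟨hb, hb2⟩)).trans hd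

theorem Good.theta {ν : Measure (E 4)} {η R : ℝ} (h : Good ν η R) (hη : η ≤ eH) {κ t : ℝ}
    (hκ : 0 < κ) (hκ1 : κ ≤ 1) (ht : 0 < t) (htR : 4 * t ≤ R) {n : E 4} (hn : ‖n‖ = 1)
    (hs : Str ν n (3 * t) (eH ^ 2 * κ / 2 * t)) : thetaP 3 (msupp ν) 0 t ≤ 2 * κ := by
  have hfin : finrank ℝ (Submodule.span ℝ {n})ᗮ = 3 := by
    have h1 := Submodule.finrank_add_finrank_orthogonal (Submodule.span ℝ {n})
    rw [finrank_span_singleton (by rintro rfl; simp at hn)] at h1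
    have : finrank ℝ (E 4) = 4 := by simp
    omega
  let L : AffineSubspace ℝ (E 4) := (Submodule.span ℝ {n})ᗮ.toAffineSubspace
  have hL : ∀ x, x ∈ L ↔ ⟪n, x⟫ = 0 := fun x => by
    rw [Submodule.mem_toAffineSubspace, Submodule.mem_orthogonal_singleton_iff_inner_right]
  have hLp : (0 : E 4) ∈ L ∧ finrank ℝ L.direction = 3 := by
    refine ⟨by rw [hL]; simp, ?_⟩
    rw [Submodule.toAffineSubspace_direction]; exact hfin
  have hbd : BddBelow (range fun L : {L : AffineSubspace ℝ (E 4) // (0 : E 4) ∈ L ∧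
      Module.finrank ℝ L.direction = 3} => Dxr 0 t (msupp ν) (L.1 : Set (E 4))) :=
    ⟨0, by rintro _ ⟨L, rfl⟩; exact Dxr_nonneg 0 ht _ _⟩
  refine (ciInf_le hbd ⟨L, hLp⟩).trans (max_le ?_ ?_)
  · refine dxr_le ht (by positivity) (fun a ha hat => ?_)
    rw [mem_closedBall, dist_zero_right] at hat
    refine ⟨a - ⟪n, a⟫ • n, ?_, ?_, ?_⟩
    · change _ ∈ L
      rw [hL, inner_sub_right, real_inner_smul_right, real_inner_self_eq_norm_sq, hn]; ring
    · rw [mem_closedBall, dist_zero_right]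
      refine le_trans (abs_le_of_sq_le_sq' ?_ (norm_nonneg a)).2 hat
      rw [norm_sub_sq_real, norm_smul, real_inner_smul_right, hn, real_inner_comm, Real.norm_eq_abs,
        mul_one, sq_abs]
      nlinarith [sq_nonneg ⟪n, a⟫]
    · rw [dist_eq_norm, sub_sub_cancel, norm_smul, hn, mul_one, Real.norm_eq_abs]
      refine (hs a ha (by linarith)).trans ?_
      gcongr
      have : eH ^ 2 ≤ 1 := by unfold eH; norm_num
      nlinarith
  · refine dxr_le ht (by positivity) (fun p hp hpt => ?_)
    rw [mem_closedBall, dist_zero_right] at hpt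
    have hp0 : ⟪n, p⟫ = 0 := (hL p).1 hp
    have hpn : ‖(1 - κ) • p‖ ≤ (1 - κ) * t := by
      rw [norm_smul, Real.norm_eq_abs, abs_of_nonneg (by linarith)]
      have : 0 ≤ 1 - κ := by linarith
      gcongr
    obtain ⟨x, hx, hxp⟩ := h.hole hη hκ hκ1 ht htR hn hs (p := (1 - κ) • p)
      (by rw [real_inner_smul_right, hp0, mul_zero]) (hpn.trans (by nlinarith))
    refine ⟨x, hx, ?_, ?_⟩
    · rw [mem_closedBall, dist_zero_right]
      have : x = (x - (1 - κ) • p) + (1 - κ) • p := by abel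
      rw [this]
      exact (norm_add_le _ _).trans (by linarith)
    · rw [dist_eq_norm]
      have : p - x = κ • p - (x - (1 - κ) • p) := by rw [sub_smul, one_smul]; abel
      rw [this]
      refine (norm_sub_le _ _).trans ?_
      have : ‖κ • p‖ ≤ κ * t := by
        rw [norm_smul, Real.norm_eq_abs, abs_of_pos hκ]; gcongr
      linarith

theorem flat_theta {ν : Measure (E 4)} {η R : ℝ} (h : Good ν η R) {r : ℝ} (hr : 0 < r)
    (hR : 1000 * r ≤ R) (hη : η ≤ etaM M2) {n0 : E 4} (hn0 : ‖n0‖ = 1)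
    (hQ0 : QQ ν r n0 ≤ eps1) (hall : ∀ η', 0 < η' → η' ≤ 1 / 10 → ∃ R', Good ν η' R') :
    Tendsto (fun r => thetaP 3 (msupp ν) 0 r) (nhdsWithin 0 (Ioi 0)) (nhds 0) := by
  rw [Metric.tendsto_nhdsWithin_nhds]
  intro ε hε
  set κ := min 1 (ε / 4) with hκ
  have hκ0 : 0 < κ := by positivity
  have hκ1 : κ ≤ 1 := min_le_left _ _
  have hκe : κ ≤ ε / 4 := min_le_right _ _
  have heH := eH_pos
  obtain ⟨ρ0, hρ0, hst⟩ := flat_strips h hr hR hη hn0 hQ0 hall (c := eH ^ 2 * κ / 6) (by positivity)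
  have hηH : η ≤ eH := (hη.trans (etaM_wD M2_ge)).trans (by unfold wD eH; norm_num)
  refine ⟨min (ρ0 / 3) (R / 4), lt_min (by positivity) (by linarith), ?_⟩
  intro t ht htd
  rw [mem_Ioi] at ht
  rw [dist_zero_right, Real.norm_eq_abs, abs_of_pos ht, lt_min_iff] at htd
  obtain ⟨n, hn, hs⟩ := hst (3 * t) (by positivity) (by linarith)
  have hth := h.theta hηH hκ0 hκ1 ht (by linarith) hn (hs.mono le_rfl (le_of_eq (by ring)))
  have hth0 : 0 ≤ thetaP 3 (msupp ν) 0 t := Real.iInf_nonneg (fun L => Dxr_nonneg 0 ht _ _)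
  rw [dist_zero_right, Real.norm_eq_abs, abs_of_nonneg hth0]
  linarith


theorem omega3_pos : 0 < omega3 := by
  unfold omega3 unitBallVol
  exact ENNReal.toReal_pos (measure_ball_pos volume _ one_pos).ne' measure_ball_lt_top.ne

/-- normalized measure -/
def nrm (μ : Measure (E 4)) : Measure (E 4) := Real.toNNReal (1 / omega3) • μ

theorem nrm_real (μ : Measure (E 4)) (A : Set (E 4)) : (nrm μ).real A = (μ A).toReal / omega3 := by
  have := omega3_pos
  unfold nrm
  rw [measureReal_nnreal_smul_apply, Real.coe_toNNReal _ (by positivity), measureReal_def]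
  ring

theorem nrm_msupp (μ : Measure (E 4)) : msupp (nrm μ) = msupp μ := by
  have h := omega3_pos
  have h2 : 0 < Real.toNNReal (1 / omega3) := Real.toNNReal_pos.2 (by positivity)
  ext x
  simp only [msupp, mem_ofPred_eq, nrm, Measure.smul_apply]
  refine forall_congr' fun r => forall_congr' fun _ => ?_
  rw [ENNReal.smul_def, smul_eq_mul, pos_iff_ne_zero, pos_iff_ne_zero, mul_ne_zero_iff]
  simp [h2.ne']
  intro _
  exact h

theorem nrm_Q (μ : Measure (E 4)) (r : ℝ) (z : E 4) : Qmom μ r z = QQ (nrm μ) r z := by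
  have h := omega3_pos
  unfold Qmom QQ nrm
  rw [Measure.restrict_smul, integral_smul_nnreal_measure, NNReal.smul_def,
    Real.coe_toNNReal _ (by positivity), smul_eq_mul]
  field_simp

theorem nrm_dens {μ : Measure (E 4)} {α C₀ : ℝ}
    (hd : ∀ x ∈ msupp μ ∩ closedBall (0 : E 4) 1, ∀ r : ℝ, 0 < r → r ≤ 1 →
        |(μ (closedBall x r)).toReal / (omega3 * r ^ 3) - 1| ≤ C₀ * r ^ α) {x : E 4}
    (hx : x ∈ msupp (nrm μ)) (hx1 : ‖x‖ ≤ 1) {t : ℝ} (ht : 0 < t) (ht1 : t ≤ 1) :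
    |(nrm μ).real (closedBall x t) - t ^ 3| ≤ |C₀| * t ^ α * t ^ 3 := by
  rw [nrm_msupp] at hx
  have h := omega3_pos
  have k := hd x ⟨hx, by simpa using hx1⟩ t ht ht1
  have e : (nrm μ).real (closedBall x t) - t ^ 3 =
      ((μ (closedBall x t)).toReal / (omega3 * t ^ 3) - 1) * t ^ 3 := by
    rw [nrm_real]; field_simp
  rw [e, abs_mul, abs_of_pos (show 0 < t ^ 3 by positivity)]
  gcongr
  refine k.trans ?_
  gcongr
  exact le_abs_self _

theorem nrm_good {μ : Measure (E 4)} (hμ : IsLocallyFiniteMeasure μ) (h0 : (0 : E 4) ∈ msupp μ) {α C₀ : ℝ}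
    (hα : 0 < α)
    (hd : ∀ x ∈ msupp μ ∩ closedBall (0 : E 4) 1, ∀ r : ℝ, 0 < r → r ≤ 1 →
        |(μ (closedBall x r)).toReal / (omega3 * r ^ 3) - 1| ≤ C₀ * r ^ α) {η R : ℝ} (hR : 0 < R)
    (hR1 : R ≤ 1) (hη : |C₀| * R ^ α ≤ η) (hη1 : η ≤ 1 / 10) : Good (nrm μ) η R := by
  refine ⟨by unfold nrm; infer_instance, by rwa [nrm_msupp], hR, hη1, fun x hx hxR t ht htR => ?_⟩
  refine (nrm_dens hd hx (hxR.trans hR1) ht (htR.trans hR1)).trans ?_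
  gcongr
  refine le_trans ?_ hη
  gcongr

theorem nrm_crude {μ : Measure (E 4)} (hμ : IsLocallyFiniteMeasure μ) (h0 : (0 : E 4) ∈ msupp μ) {α C₀ : ℝ}
    (hα : 0 < α)
    (hd : ∀ x ∈ msupp μ ∩ closedBall (0 : E 4) 1, ∀ r : ℝ, 0 < r → r ≤ 1 →
        |(μ (closedBall x r)).toReal / (omega3 * r ^ 3) - 1| ≤ C₀ * r ^ α) {r : ℝ} (hr : 0 < r)
    (hr1 : r ≤ 1) {z : E 4} (hz : ‖z‖ ≤ 2) : |QQ (nrm μ) r z - ‖z‖ ^ 2| ≤ 24 + 20 * |C₀| := by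
  have h1 := (abs_le.1 (nrm_dens hd (x := 0) (by rwa [nrm_msupp]) (by simp) hr hr1)).2
  have h2 : r ^ α ≤ 1 := Real.rpow_le_one hr.le hr1 hα.le
  have h3 : (nrm μ).real (closedBall 0 r) ≤ (1 + |C₀|) * r ^ 3 := by
    have : |C₀| * r ^ α * r ^ 3 ≤ |C₀| * 1 * r ^ 3 := by gcongr
    linarith
  have hlf : IsLocallyFiniteMeasure (nrm μ) := by unfold nrm; infer_instance
  have h4 : ‖∫ w in closedBall (0 : E 4) r, ⟪z, w⟫ ^ 2 ∂(nrm μ)‖ ≤ (2 * r) ^ 2 * (nrm μ).real (closedBall 0 r) := by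
    refine norm_setIntegral_le_of_norm_le_const measure_closedBall_lt_top (fun w hw => ?_)
    rw [mem_closedBall, dist_zero_right] at hw
    rw [Real.norm_eq_abs, abs_pow]
    have : |⟪z, w⟫| ≤ 2 * r := (abs_real_inner_le_norm _ _).trans (by gcongr)
    gcongr
  have h5 : QQ (nrm μ) r z ≤ 20 * (1 + |C₀|) := by
    calc QQ (nrm μ) r z ≤ 5 / r ^ 5 * ((2 * r) ^ 2 * ((1 + |C₀|) * r ^ 3)) := by
          unfold QQ
          gcongr
          refine (le_abs_self _).trans (h4.trans ?_)
          gcongr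
      _ = _ := by field_simp; ring
  have h6 := Good.QQ_nonneg (ν := nrm μ) hr z
  have h7 : ‖z‖ ^ 2 ≤ 2 ^ 2 := by gcongr
  rw [abs_le]
  have := abs_nonneg C₀
  constructor <;> nlinarith [sq_nonneg ‖z‖]

theorem thresholds (α A θ : ℝ) (hα : 0 < α) (hθα : θ < α / 2) (hA : 0 ≤ A) (K k1 η0 : ℝ)
    (hk1 : 0 < k1) (hη0 : 0 < η0) : ∃ r0 : ℝ, 0 < r0 ∧ ∀ r, 0 < r → r < r0 →
      1000 * r ≤ 1 ∧ A * (1000 * r) ^ α ≤ η0 ∧ r ^ (α / 2) ≤ 1 / 2 ∧ K * r ^ (α / 2 - θ) ≤ k1 := by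
  have T : ∀ β : ℝ, 0 < β → Tendsto (fun r : ℝ => r ^ β) (𝓝[>] 0) (𝓝 0) := by
    intro β hβ
    have := (Real.continuousAt_rpow_const 0 β (Or.inr hβ.le)).tendsto
    rw [Real.zero_rpow hβ.ne'] at this
    exact this.mono_left nhdsWithin_le_nhds
  have e1 : ∀ᶠ r : ℝ in 𝓝[>] 0, 1000 * r ≤ 1 := by
    have : Tendsto (fun r : ℝ => 1000 * r) (𝓝[>] 0) (𝓝 (1000 * 0)) :=
      (Continuous.tendsto (by fun_prop) 0).mono_left nhdsWithin_le_nhds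
    rw [mul_zero] at this
    exact this.eventually_le_const one_pos
  have e2 : ∀ᶠ r : ℝ in 𝓝[>] 0, A * 1000 ^ α * r ^ α ≤ η0 := by
    have := (T α hα).const_mul (A * 1000 ^ α)
    rw [mul_zero] at this
    exact this.eventually_le_const hη0
  have e3 : ∀ᶠ r : ℝ in 𝓝[>] 0, r ^ (α / 2) ≤ 1 / 2 :=
    (T (α / 2) (by linarith)).eventually_le_const (by norm_num)
  have e4 : ∀ᶠ r : ℝ in 𝓝[>] 0, K * r ^ (α / 2 - θ) ≤ k1 := by
    have := (T (α / 2 - θ) (by linarith)).const_mul K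
    rw [mul_zero] at this
    exact this.eventually_le_const hk1
  obtain ⟨r0, hr0, hsub⟩ := mem_nhdsGT_iff_exists_Ioo_subset.1 (e1.and (e2.and (e3.and e4)))
  refine ⟨r0, hr0, fun r hr hrr => ?_⟩
  obtain ⟨a1, a2, a3, a4⟩ := hsub ⟨hr, hrr⟩
  refine ⟨a1, ?_, a3, a4⟩
  rw [Real.mul_rpow (by norm_num) hr.le, ← mul_assoc]
  exact a2

theorem main_small {μ : Measure (E 4)} (hμ : IsLocallyFiniteMeasure μ) (h0 : (0 : E 4) ∈ msupp μ)
    {α C₀ θ : ℝ} (hα : 0 < α)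
    (hnf : ¬ Tendsto (fun r : ℝ => thetaP 3 (msupp μ) 0 r) (nhdsWithin 0 (Set.Ioi 0)) (nhds 0))
    (hd : ∀ x ∈ msupp μ ∩ closedBall (0 : E 4) 1, ∀ r : ℝ, 0 < r → r ≤ 1 →
        |(μ (closedBall x r)).toReal / (omega3 * r ^ 3) - 1| ≤ C₀ * r ^ α)
    {r : ℝ} (hr : 0 < r) (r1 : 1000 * r ≤ 1) (r2 : |C₀| * (1000 * r) ^ α ≤ etaM M2)
    (r3 : r ^ (α / 2) ≤ 1 / 2)
    {k1 : ℝ} (hk1 : 10 * k1 ^ 2 ≤ eps1)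
    (r4 : (130 + 120 * (|C₀| * 2 ^ α)) * r ^ (α / 2 - θ) ≤ k1) :
    Good (nrm μ) (|C₀| * (2 * r) ^ α) (2 * r) ∧ ‖bet (nrm μ) r‖ ≤ r ^ (1 + θ) := by
  have hη1 : etaM M2 ≤ 1 / 10 := (etaM_wD M2_ge).trans (by unfold wD; norm_num)
  have hA := abs_nonneg C₀
  have g1 : Good (nrm μ) (|C₀| * (2 * r) ^ α) (2 * r) := by
    refine nrm_good hμ h0 hα hd (by positivity) (by linarith) le_rfl ?_
    refine le_trans ?_ (r2.trans hη1)
    gcongr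
    norm_num
  refine ⟨g1, ?_⟩
  by_contra hc
  push Not at hc
  apply hnf
  have g2 : Good (nrm μ) (etaM M2) (1000 * r) :=
    nrm_good hμ h0 hα hd (by positivity) r1 r2 hη1
  set ρ := r * r ^ (α / 2) with hρ
  have hp : 0 < r ^ (α / 2) := by positivity
  have hρ0 : 0 < ρ := by positivity
  have hρr : ρ ≤ r / 2 := by rw [hρ]; nlinarith
  have hρ2 : ρ ^ 2 = r ^ 2 * r ^ α := by
    rw [hρ, mul_pow, ← Real.rpow_natCast (r ^ (α / 2)) 2, ← Real.rpow_mul hr.le]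
    congr 2
    push_cast
    ring
  have hB0 : 0 < ‖bet (nrm μ) r‖ := lt_trans (by positivity) hc
  have hk10 : 0 ≤ k1 := le_trans (by positivity) r4
  have hstr : ∀ x ∈ msupp (nrm μ), ‖x‖ ≤ ρ →
      |⟪‖bet (nrm μ) r‖⁻¹ • bet (nrm μ) r, x⟫| ≤ k1 * ρ := by
    intro x hx hxρ
    have k := g1.star_bet hr le_rfl hx (hxρ.trans hρr)
    rw [real_inner_smul_left, abs_mul, abs_of_pos (by positivity), inv_mul_le_iff₀ hB0]
    have e1 : ‖x‖ ^ 2 ≤ ρ ^ 2 := by gcongr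
    have e2 : ‖x‖ ^ 3 / r ≤ ρ ^ 2 := by
      rw [div_le_iff₀ hr]
      calc ‖x‖ ^ 3 ≤ ρ ^ 3 := by gcongr
        _ = ρ ^ 2 * ρ := by ring
        _ ≤ _ := by gcongr; linarith
    have e3 : |C₀| * (2 * r) ^ α * r ^ 2 = |C₀| * 2 ^ α * ρ ^ 2 := by
      rw [hρ2, Real.mul_rpow (by norm_num) hr.le]; ring
    have e4 : r ^ (α / 2 - θ) * r ^ (1 + θ) = ρ := by
      rw [← Real.rpow_add hr, hρ]
      have : α / 2 - θ + (1 + θ) = 1 + α / 2 := by ring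
      rw [this, Real.rpow_add hr, Real.rpow_one]
    rw [e3] at k
    calc |⟪bet (nrm μ) r, x⟫| ≤ (130 + 120 * (|C₀| * 2 ^ α)) * ρ ^ 2 := by nlinarith
      _ = (130 + 120 * (|C₀| * 2 ^ α)) * r ^ (α / 2 - θ) * r ^ (1 + θ) * ρ := by
        rw [mul_assoc _ (r ^ (α / 2 - θ)), e4]; ring
      _ ≤ k1 * ‖bet (nrm μ) r‖ * ρ := by gcongr
      _ = _ := by ring
  have hQ : QQ (nrm μ) ρ (‖bet (nrm μ) r‖⁻¹ • bet (nrm μ) r) ≤ eps1 :=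
    (g1.QQ_strip hρ0 (by linarith) hstr).trans hk1
  have := flat_theta g2 hρ0 (by linarith) le_rfl (n0 := ‖bet (nrm μ) r‖⁻¹ • bet (nrm μ) r)
    (by rw [norm_smul]; simp; field_simp) hQ ?_
  · rwa [nrm_msupp] at this
  · intro η' h1 h2
    obtain ⟨r0, hr0, hh⟩ := thresholds α |C₀| 0 hα (by linarith) hA 0 1 η' one_pos h1
    obtain ⟨a1, a2, -, -⟩ := hh (r0 / 2) (by positivity) (by linarith)
    exact ⟨1000 * (r0 / 2), nrm_good hμ h0 hα hd (by positivity) a1 a2 h2⟩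

theorem second_moment_controlX (α C₀ θ : ℝ) (hα : 0 < α) (hθ : 0 < θ) (hθα : θ < α / 2) :
    ∃ C : ℝ, ∀ μ : Measure (E 4), IsLocallyFiniteMeasure μ →
      ∀ S : Set (E 4), S = msupp μ → (0 : E 4) ∈ S →
      ¬ Tendsto (fun r : ℝ => thetaP 3 S 0 r) (nhdsWithin 0 (Set.Ioi 0)) (nhds 0) →
      (∀ x ∈ S ∩ closedBall (0 : E 4) 1, ∀ r : ℝ, 0 < r → r ≤ 1 →
        |(μ (closedBall x r)).toReal / (omega3 * r ^ 3) - 1| ≤ C₀ * r ^ α) →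
      ∀ r s : ℝ, 0 < r → r ≤ 1 / 2 → 0 < s → s ≤ r / 4 →
        ∀ z : E 4, s • z ∈ S → z ∈ closedBall (0 : E 4) 2 →
          |Qmom μ r z - ‖z‖ ^ 2| ≤
            C * (s / r) + C * r ^ (2 + α) / s ^ 2 + C * r ^ (1 + θ) / s := by
  have hA := abs_nonneg C₀
  have hq := qq_pos
  have hk1 : 10 * (qq ^ 5 / 100) ^ 2 ≤ eps1 := by
    unfold eps1
    nlinarith [sq_nonneg (qq ^ 5)]
  obtain ⟨r0, hr0, hth⟩ := thresholds α |C₀| θ hα hθα hA (130 + 120 * (|C₀| * 2 ^ α)) (qq ^ 5 / 100)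
    (etaM M2) (by positivity) (etaM_pos M2_ge)
  have hr0θ : 0 < r0 ^ θ := by positivity
  refine ⟨960 + 120 * (|C₀| * 2 ^ α) + (24 + 20 * |C₀|) / r0 ^ θ, ?_⟩
  set C := 960 + 120 * (|C₀| * 2 ^ α) + (24 + 20 * |C₀|) / r0 ^ θ with hC
  have c1 : 0 ≤ 120 * (|C₀| * 2 ^ α) := by positivity
  have c2 : 0 ≤ (24 + 20 * |C₀|) / r0 ^ θ := by positivity
  have c0 : 0 ≤ C := by positivity
  rintro μ hμ S rfl h0 hnf hd r s hr hr2 hs hsr z hzS hz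
  rw [mem_closedBall, dist_zero_right] at hz
  rw [nrm_Q]
  have t1 : 0 ≤ s / r := by positivity
  have t2 : 0 ≤ r ^ (2 + α) / s ^ 2 := by positivity
  have t3 : 0 ≤ r ^ (1 + θ) / s := by positivity
  rw [mul_div_assoc, mul_div_assoc]
  rcases le_or_gt r0 r with hc | hc
  · refine (nrm_crude hμ h0 hα hd hr (by linarith) hz).trans ?_
    have e1 : r0 ^ θ ≤ r ^ (1 + θ) / s := by
      rw [le_div_iff₀ hs, Real.rpow_add hr, Real.rpow_one]
      calc r0 ^ θ * s ≤ r ^ θ * r := by gcongr; linarith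
        _ = _ := mul_comm _ _
    have e2 : 24 + 20 * |C₀| ≤ C * (r ^ (1 + θ) / s) := by
      calc 24 + 20 * |C₀| = (24 + 20 * |C₀|) / r0 ^ θ * r0 ^ θ := by field_simp
        _ ≤ C * (r ^ (1 + θ) / s) := by
          gcongr
          rw [hC]; linarith
    have e3 : 0 ≤ C * (s / r) := by positivity
    have e4 : 0 ≤ C * (r ^ (2 + α) / s ^ 2) := by positivity
    linarith
  · obtain ⟨a1, a2, a3, a4⟩ := hth r hr hc
    obtain ⟨g, hbet⟩ := main_small hμ h0 hα hnf hd hr a1 a2 a3 hk1 a4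
    have hx : ‖s • z‖ ≤ 2 * s := by
      rw [norm_smul, Real.norm_eq_abs, abs_of_pos hs]; nlinarith
    have k := g.star hr le_rfl (x := s • z) (by rwa [nrm_msupp]) (by linarith)
    rw [Good.QQ_smul, norm_smul s z, Real.norm_eq_abs, abs_of_pos hs] at k
    have b1 : |⟪bet (nrm μ) r, s • z⟫| ≤ r ^ (1 + θ) * (2 * s) :=
      (abs_real_inner_le_norm _ _).trans (by gcongr)
    have b2 : (s * ‖z‖) ^ 3 / r ≤ 8 * s ^ 3 / r := by
      gcongr
      calc (s * ‖z‖) ^ 3 ≤ (s * 2) ^ 3 := by gcongr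
        _ = _ := by ring
    have b3 : |C₀| * (2 * r) ^ α * r ^ 2 = |C₀| * 2 ^ α * r ^ (2 + α) := by
      rw [Real.mul_rpow (by norm_num) hr.le, Real.rpow_add hr, Real.rpow_two]; ring
    have b4 : s ^ 2 * |QQ (nrm μ) r z - ‖z‖ ^ 2| ≤ r ^ (1 + θ) * (2 * s) +
        120 * (8 * s ^ 3 / r + |C₀| * 2 ^ α * r ^ (2 + α)) := by
      rw [b3] at k
      have hh : ∀ X : ℝ, s ^ 2 * |X| = |s ^ 2 * X| := fun X => by rw [abs_mul, abs_of_pos (show 0 < s ^ 2 by positivity)]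
      rw [hh]
      obtain ⟨k2, k3⟩ := abs_le.1 k
      obtain ⟨k4, k5⟩ := abs_le.1 b1
      rw [abs_le]
      constructor <;> linarith
    have b5 : r ^ (1 + θ) * (2 * s) + 120 * (8 * s ^ 3 / r + |C₀| * 2 ^ α * r ^ (2 + α)) =
        s ^ 2 * (2 * (r ^ (1 + θ) / s) + 960 * (s / r) + 120 * (|C₀| * 2 ^ α) * (r ^ (2 + α) / s ^ 2)) := by
      field_simp
      ring
    rw [b5] at b4
    refine (le_of_mul_le_mul_left b4 (by positivity)).trans ?_
    have d1 : 960 * (s / r) ≤ C * (s / r) := by gcongr; linarith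
    have d2 : 120 * (|C₀| * 2 ^ α) * (r ^ (2 + α) / s ^ 2) ≤ C * (r ^ (2 + α) / s ^ 2) := by
      gcongr; linarith
    have d3 : 2 * (r ^ (1 + θ) / s) ≤ C * (r ^ (1 + θ) / s) := by gcongr; linarith
    linarith

/-- Theorem 4.3(4) / `DKTbounds`: control of the second moment of a
Hölder asymptotically uniform measure on `ℝ⁴` at a nonflat point. -/
theorem second_moment_control (α C₀ θ : ℝ) (hα : 0 < α) (hθ : 0 < θ) (hθα : θ < α / 2) :
    ∃ C : ℝ, ∀ μ : Measure (E 4), IsLocallyFiniteMeasure μ →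
      ∀ S : Set (E 4), S = msupp μ → (0 : E 4) ∈ S →
      ¬ Tendsto (fun r : ℝ => thetaP 3 S 0 r) (nhdsWithin 0 (Set.Ioi 0)) (nhds 0) →
      (∀ x ∈ S ∩ closedBall (0 : E 4) 1, ∀ r : ℝ, 0 < r → r ≤ 1 →
        |(μ (closedBall x r)).toReal / (omega3 * r ^ 3) - 1| ≤ C₀ * r ^ α) →
      ∀ r s : ℝ, 0 < r → r ≤ 1 / 2 → 0 < s → s ≤ r / 4 →
        ∀ z : E 4, s • z ∈ S → z ∈ closedBall (0 : E 4) 2 →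
          |Qmom μ r z - ‖z‖ ^ 2| ≤
            C * (s / r) + C * r ^ (2 + α) / s ^ 2 + C * r ^ (1 + θ) / s := by
  exact second_moment_controlX α C₀ θ hα hθ hθα
end
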